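/- (Theorem 3, NBIC selection consistency) Under conditions (C1) and (C2), with adaptive weights w_k = 1/|θ̂_{MLE,k}|, for any deterministic reference sequence λ°_N of regularization parameters satisfying λ°_N ≍ log N (i.e., c₁ log N ≤ λ°_N ≤ c₂ log N for constants 0 < c₁ ≤ c₂ and all large N), one has P( inf_{λ ∈ Ω₋ ∪ Ω₊} NBIC_λ > NBIC_{λ°_N} ) → 1 as N → ∞. -/

import Mathlib

open Finset Real
open scoped Classical

noncomputable section

variable {E : Type*}

/-- Numeric 0/1 value of a Boolean edge indicator. -/
def bval (b : Bool) : ℝ := if b then 1 else 0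

/-- Ordered pairs `(j1, j2)` of nodes with `j1 < j2` (the dyads). -/
def pairsLT (n : ℕ) : Finset (Fin n × Fin n) := univ.filter fun q => q.1 < q.2

/-- Ordered pairs `(j1, j2)` of nodes with `j1 ≠ j2` (the potential directed edges). -/
def pairsNE (n : ℕ) : Finset (Fin n × Fin n) := univ.filter fun q => q.1 ≠ q.2

/-- The finite set of zero-diagonal binary adjacency matrices on `n` nodes. -/
def nets (n : ℕ) : Finset (Fin n → Fin n → Bool) :=
  univ.filter fun x => ∀ j, x j j = false

/-- The exponent `H_θ(x)` of the directed network model with nodal homophily and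
nodal effects, with parameter `θ = (θ1, θ2, γ, ζ, η)`. -/
def Hexp (n m : ℕ) (v : Fin n → Fin m → E) (w : E → E → ℝ) (g : E → ℝ)
    (θ1 θ2 : ℝ) (γ ζ η : Fin m → ℝ) (x : Fin n → Fin n → Bool) : ℝ :=
  θ1 * ∑ q ∈ pairsLT n, bval (x q.1 q.2) * bval (x q.2 q.1)
    + θ2 * ∑ q ∈ pairsNE n, bval (x q.1 q.2)
    + ∑ k, γ k * ∑ q ∈ pairsNE n, bval (x q.1 q.2) * w (v q.1 k) (v q.2 k)
    + ∑ k, ζ k * ∑ q ∈ pairsNE n, bval (x q.1 q.2) * g (v q.1 k)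
    + ∑ k, η k * ∑ q ∈ pairsNE n, bval (x q.1 q.2) * g (v q.2 k)

/-- The dyad weight `T_{ab}(j1, j2)`; note `T_{00}(j1,j2) = 1`. -/
def Tdyad (n m : ℕ) (v : Fin n → Fin m → E) (w : E → E → ℝ) (g : E → ℝ)
    (θ1 θ2 : ℝ) (γ ζ η : Fin m → ℝ) (j1 j2 : Fin n) (a b : Bool) : ℝ :=
  Real.exp (θ1 * (bval a * bval b)
    + (bval a + bval b) * (θ2 + ∑ k, γ k * w (v j1 k) (v j2 k))
    + ∑ k, ζ k * (bval a * g (v j1 k) + bval b * g (v j2 k))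
    + ∑ k, η k * (bval a * g (v j2 k) + bval b * g (v j1 k)))

/-- The normalizing constant `z(θ)` of the directed network model. -/
def zconst (n m : ℕ) (v : Fin n → Fin m → E) (w : E → E → ℝ) (g : E → ℝ)
    (θ1 θ2 : ℝ) (γ ζ η : Fin m → ℝ) : ℝ :=
  ∑ x ∈ nets n, Real.exp (Hexp n m v w g θ1 θ2 γ ζ η x)

/-- The probability mass function `P_θ(X = x) = exp H_θ(x) / z(θ)`. -/
def Pnet (n m : ℕ) (v : Fin n → Fin m → E) (w : E → E → ℝ) (g : E → ℝ)
    (θ1 θ2 : ℝ) (γ ζ η : Fin m → ℝ) (x : Fin n → Fin n → Bool) : ℝ :=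
  Real.exp (Hexp n m v w g θ1 θ2 γ ζ η x) / zconst n m v w g θ1 θ2 γ ζ η

/-- The marginal probability `P_θ(X_{j1j2} = a, X_{j2j1} = b)` of a dyad. -/
def Pdyad (n m : ℕ) (v : Fin n → Fin m → E) (w : E → E → ℝ) (g : E → ℝ)
    (θ1 θ2 : ℝ) (γ ζ η : Fin m → ℝ) (j1 j2 : Fin n) (a b : Bool) : ℝ :=
  ∑ x ∈ (nets n).filter (fun x => x j1 j2 = a ∧ x j2 j1 = b),
    Pnet n m v w g θ1 θ2 γ ζ η x

/-- The marginal probability `P_θ(X_{j1j2} = a)` of a single directed edge indicator. -/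
def Pedge (n m : ℕ) (v : Fin n → Fin m → E) (w : E → E → ℝ) (g : E → ℝ)
    (θ1 θ2 : ℝ) (γ ζ η : Fin m → ℝ) (j1 j2 : Fin n) (a : Bool) : ℝ :=
  ∑ x ∈ (nets n).filter (fun x => x j1 j2 = a), Pnet n m v w g θ1 θ2 γ ζ η x

/-- Index type for the parameter space `ℝ^p` with `p = 3m + 2`: two global parameters
`(θ1, θ2)`, the homophily block, the out-edge block and the in-edge block. -/
abbrev Idx (m : ℕ) := Fin 2 ⊕ (Fin m ⊕ (Fin m ⊕ Fin m))

/-- The vector of sufficient statistics `s(x) ∈ ℝ^p`: the coefficient of each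
coordinate of `θ` in `H_θ(x)`. -/
def svec (n m : ℕ) (v : Fin n → Fin m → E) (w : E → E → ℝ) (g : E → ℝ)
    (x : Fin n → Fin n → Bool) : Idx m → ℝ
  | Sum.inl i =>
      if i = 0 then ∑ q ∈ pairsLT n, bval (x q.1 q.2) * bval (x q.2 q.1)
      else ∑ q ∈ pairsNE n, bval (x q.1 q.2)
  | Sum.inr (Sum.inl k) => ∑ q ∈ pairsNE n, bval (x q.1 q.2) * w (v q.1 k) (v q.2 k)
  | Sum.inr (Sum.inr (Sum.inl k)) => ∑ q ∈ pairsNE n, bval (x q.1 q.2) * g (v q.1 k)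
  | Sum.inr (Sum.inr (Sum.inr k)) => ∑ q ∈ pairsNE n, bval (x q.1 q.2) * g (v q.2 k)

/-- The exponent of the model written as `H_θ(x) = θᵀ s(x)`. -/
def Hvec (n m : ℕ) (v : Fin n → Fin m → E) (w : E → E → ℝ) (g : E → ℝ)
    (θ : Idx m → ℝ) (x : Fin n → Fin n → Bool) : ℝ :=
  ∑ i, θ i * svec n m v w g x i

/-- The normalizing constant (partition function) `z(θ)`. -/
def Zvec (n m : ℕ) (v : Fin n → Fin m → E) (w : E → E → ℝ) (g : E → ℝ)
    (θ : Idx m → ℝ) : ℝ :=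
  ∑ x ∈ nets n, Real.exp (Hvec n m v w g θ x)

/-- The probability mass function `P_θ(X = x) = exp H_θ(x)/z(θ)`. -/
def Pvec (n m : ℕ) (v : Fin n → Fin m → E) (w : E → E → ℝ) (g : E → ℝ)
    (θ : Idx m → ℝ) (x : Fin n → Fin n → Bool) : ℝ :=
  Real.exp (Hvec n m v w g θ x) / Zvec n m v w g θ

/-- Expectation of a real statistic under `P_θ`. -/
def Emean (n m : ℕ) (v : Fin n → Fin m → E) (w : E → E → ℝ) (g : E → ℝ)
    (θ : Idx m → ℝ) (f : (Fin n → Fin n → Bool) → ℝ) : ℝ :=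
  ∑ x ∈ nets n, f x * Pvec n m v w g θ x

/-- The number of dyads `N = n(n−1)/2`. -/
def Ndyads (n : ℕ) : ℕ := n * (n - 1) / 2

/-- The Euclidean norm on `ℝ^p`. -/
def enorm {m : ℕ} (u : Idx m → ℝ) : ℝ := Real.sqrt (∑ i, u i ^ 2)

/-- The log-likelihood `L_N(θ) = H_θ(x) − log z(θ)` at the observed network `x`. -/
def Llik (n m : ℕ) (v : Fin n → Fin m → E) (w : E → E → ℝ) (g : E → ℝ)
    (θ : Idx m → ℝ) (x : Fin n → Fin n → Bool) : ℝ :=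
  Hvec n m v w g θ x - Real.log (Zvec n m v w g θ)

/-- Probability, under `P_{θ0}`, of the event `φ` (a set of zero-diagonal networks). -/
def Pr (n m : ℕ) (v : Fin n → Fin m → E) (w : E → E → ℝ) (g : E → ℝ)
    (θ0 : Idx m → ℝ) (φ : (Fin n → Fin n → Bool) → Prop) : ℝ :=
  ∑ x ∈ (nets n).filter (fun x => φ x), Pvec n m v w g θ0 x

/-- The Fisher information matrix `I_N(θ0) = Cov_{θ0}(∇_θ L_N(θ0))`.  Since the score
is `∇_θ L_N(θ0) = s(X) − E_{θ0}[s(X)]`, this is the covariance matrix of the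
sufficient statistic `s(X)` under `P_{θ0}`. -/
def Ifish (n m : ℕ) (v : Fin n → Fin m → E) (w : E → E → ℝ) (g : E → ℝ)
    (θ0 : Idx m → ℝ) : Matrix (Idx m) (Idx m) ℝ :=
  Matrix.of fun k l =>
    Emean n m v w g θ0 (fun x => svec n m v w g x k * svec n m v w g x l)
      - Emean n m v w g θ0 (fun x => svec n m v w g x k)
          * Emean n m v w g θ0 (fun x => svec n m v w g x l)

/-- Condition (C1): the dyad covariate vectors `S_{j1j2}` (whose entries are `1`, `2`,
`w(v_{j1k}, v_{j2k})`, `g(v_{j1k})` and `g(v_{j2k})`) are uniformly bounded over `n`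
and over dyads, and `θ0` lies in the interior of a compact convex set `Θ ⊂ ℝ^p`. -/
def CondC1 {E : Type*} (m : ℕ) (v : (n : ℕ) → Fin n → Fin m → E)
    (w : E → E → ℝ) (g : E → ℝ) (θ0 : Idx m → ℝ) (Θ : Set (Idx m → ℝ)) : Prop :=
  (∃ B : ℝ, ∀ (n : ℕ) (j1 j2 : Fin n) (k : Fin m),
      |w (v n j1 k) (v n j2 k)| ≤ B ∧ |g (v n j1 k)| ≤ B)
    ∧ IsCompact Θ ∧ Convex ℝ Θ ∧ θ0 ∈ interior Θ

/-- Condition (C2): `N⁻¹ I_N(θ0)` converges, as `n → ∞`, to a positive definite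
matrix `I(θ0)`. -/
def CondC2 {E : Type*} (m : ℕ) (v : (n : ℕ) → Fin n → Fin m → E)
    (w : E → E → ℝ) (g : E → ℝ) (θ0 : Idx m → ℝ)
    (Imat : Matrix (Idx m) (Idx m) ℝ) : Prop :=
  Filter.Tendsto (fun n : ℕ => ((Ndyads n : ℝ))⁻¹ • Ifish n m (v n) w g θ0)
      Filter.atTop (nhds Imat)
    ∧ Imat.PosDef

/-- The network Bayesian information criterion evaluated at the estimate `θ` based on
the observed network `x`: `NBIC = −N^{−1/2} L_N(θ) + (log N)·DF`, where `DF` is the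
number of nonzero coordinates of `θ`. -/
def NBICval (n m : ℕ) (v : Fin n → Fin m → E) (w : E → E → ℝ) (g : E → ℝ)
    (θ : Idx m → ℝ) (x : Fin n → Fin n → Bool) : ℝ :=
  -(Real.sqrt (Ndyads n))⁻¹ * Llik n m v w g θ x
    + Real.log (Ndyads n)
        * (((Finset.univ : Finset (Idx m)).filter fun k => θ k ≠ 0).card : ℝ)

section FiniteProbability

variable {α : Type*} [Fintype α] {p : α → ℝ}

theorem abs_weighted_sum_le (hp : ∀ a, 0 ≤ p a) (hp1 : ∑ a, p a = 1) {f : α → ℝ} {C : ℝ}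
    (hf : ∀ a, |f a| ≤ C) : |∑ a, f a * p a| ≤ C := by
  calc |∑ a, f a * p a| ≤ ∑ a, |f a * p a| := Finset.abs_sum_le_sum_abs _ _
    _ ≤ ∑ a, C * p a := by
        refine Finset.sum_le_sum fun a _ => ?_
        rw [abs_mul, abs_of_nonneg (hp a)]
        exact mul_le_mul_of_nonneg_right (hf a) (hp a)
    _ = C := by rw [← Finset.mul_sum, hp1, mul_one]

theorem one_add_add_sq_div_le_exp {K x : ℝ} (hK : 2 ≤ K) (hx : |x| ≤ K) :
    1 + x + x ^ 2 / (2 * K) ≤ Real.exp x := by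
  have hK0 : 0 < 2 * K := by linarith
  rcases le_or_gt (-2) x with h | h
  · have h1 : 1 + x / 2 ≤ Real.exp (x / 2) := by linarith [Real.add_one_le_exp (x / 2)]
    have h2 : Real.exp x = Real.exp (x / 2) ^ 2 := by
      rw [← Real.exp_nat_mul]; congr 1; push_cast; ring
    have h3 : (1 + x / 2) ^ 2 ≤ Real.exp (x / 2) ^ 2 := by
      apply pow_le_pow_left₀ _ h1; linarith
    have h4 : x ^ 2 / (2 * K) ≤ x ^ 2 / 4 :=
      div_le_div_of_nonneg_left (sq_nonneg x) (by norm_num) (by linarith)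
    rw [h2]; nlinarith
  · have h1 : x ^ 2 / (2 * K) ≤ -1 - x := by
      rw [div_le_iff₀ hK0]
      have := (abs_le.1 hx).1
      nlinarith
    linarith [Real.exp_pos x]

/-- For a bounded centred variable the cumulant generating function at `1` dominates a multiple
of the variance. -/
theorem variance_le_log_sum_exp (hp : ∀ a, 0 ≤ p a) (hp1 : ∑ a, p a = 1) {f : α → ℝ} {K : ℝ}
    (hK : 2 ≤ K) (hf : ∀ a, |f a| ≤ K) (h0 : ∑ a, f a * p a = 0) :
    (∑ a, f a ^ 2 * p a) / (2 * K ^ 2) ≤ Real.log (∑ a, Real.exp (f a) * p a) := by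
  set V := ∑ a, f a ^ 2 * p a with hV
  have hV0 : 0 ≤ V := Finset.sum_nonneg fun a _ => mul_nonneg (sq_nonneg _) (hp a)
  have hVK : V ≤ K ^ 2 := by
    refine (le_abs_self _).trans (abs_weighted_sum_le hp hp1 fun a => ?_)
    rw [abs_of_nonneg (sq_nonneg _)]
    exact sq_le_sq' (by linarith [(abs_le.1 (hf a)).1]) (abs_le.1 (hf a)).2
  have h1 : 1 + V / (2 * K) ≤ ∑ a, Real.exp (f a) * p a := by
    calc 1 + V / (2 * K) = ∑ a, (1 + f a + f a ^ 2 / (2 * K)) * p a := by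
          simp only [add_mul, Finset.sum_add_distrib, one_mul, hp1, h0, hV, Finset.sum_div]
          rw [add_zero]
          congr 1
          exact Finset.sum_congr rfl fun a _ => by ring
      _ ≤ _ := Finset.sum_le_sum fun a _ =>
          mul_le_mul_of_nonneg_right (one_add_add_sq_div_le_exp hK (hf a)) (hp a)
  have h2 : 0 < 1 + V / (2 * K) := by positivity
  refine le_trans ?_ (Real.log_le_log h2 h1)
  refine le_trans ?_ (Real.one_sub_inv_le_log_of_pos h2)
  have hK' : 0 < K := by linarith
  have h3 : 1 - (1 + V / (2 * K))⁻¹ = V / (2 * K + V) := by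
    field_simp
    ring
  rw [h3]
  refine div_le_div_of_nonneg_left hV0 (by positivity) ?_
  nlinarith

/-- Second-order expansion of the mean of `Y` under the exponential tilt by `W`. -/
theorem abs_tilted_mean_sub_le (hp : ∀ a, 0 ≤ p a) (hp1 : ∑ a, p a = 1) {Y W : α → ℝ}
    {R η : ℝ} (hη : η ≤ 1) (hY : ∀ a, |Y a| ≤ R) (hW : ∀ a, |W a| ≤ η) :
    |(∑ a, Y a * (Real.exp (W a) * p a)) / (∑ a, Real.exp (W a) * p a) - ∑ a, Y a * p a
      - (∑ a, Y a * W a * p a - (∑ a, Y a * p a) * ∑ a, W a * p a)| ≤ 18 * R * η ^ 2 := by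
  set μ := ∑ a, Y a * p a with hμ
  have hne : Nonempty α := by
    by_contra h
    rw [not_nonempty_iff] at h
    simp at hp1
  obtain ⟨a0⟩ := hne
  have hR : 0 ≤ R := (abs_nonneg _).trans (hY a0)
  have hη0 : 0 ≤ η := (abs_nonneg _).trans (hW a0)
  have hμR : |μ| ≤ R := abs_weighted_sum_le hp hp1 hY
  set Z := ∑ a, Real.exp (W a) * p a with hZ
  set c := ∑ a, (Y a - μ) * W a * p a with hc
  have hYμ : ∀ a, |Y a - μ| ≤ 2 * R := fun a => by
    linarith [abs_sub (Y a) μ, hY a]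
  have hcov : ∑ a, Y a * W a * p a - μ * ∑ a, W a * p a = c := by
    rw [hc, Finset.mul_sum, ← Finset.sum_sub_distrib]
    exact Finset.sum_congr rfl fun a _ => by ring
  have hZlow : 1 / 3 ≤ Z := by
    have : (1 : ℝ) / 3 = ∑ a, 1 / 3 * p a := by rw [← Finset.mul_sum, hp1, mul_one]
    rw [this]
    refine Finset.sum_le_sum fun a _ => mul_le_mul_of_nonneg_right ?_ (hp a)
    have h1 : Real.exp (-1) ≤ Real.exp (W a) :=
      Real.exp_le_exp.2 (by linarith [(abs_le.1 (hW a)).1])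
    have h2 : (1 : ℝ) / 3 ≤ Real.exp (-1) := by
      rw [Real.exp_neg, one_div]
      exact inv_anti₀ (Real.exp_pos 1) (by linarith [Real.exp_one_lt_d9])
    linarith
  have hZ1 : |Z - 1| ≤ 2 * η := by
    have : Z - 1 = ∑ a, (Real.exp (W a) - 1) * p a := by
      simp only [sub_mul, Finset.sum_sub_distrib, one_mul, hp1, hZ]
    rw [this]
    refine abs_weighted_sum_le hp hp1 fun a => ?_
    exact (Real.abs_exp_sub_one_le ((hW a).trans hη)).trans (by linarith [hW a])
  have hcR : |c| ≤ 2 * R * η := by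
    refine abs_weighted_sum_le hp hp1 fun a => ?_
    rw [abs_mul]
    exact mul_le_mul (hYμ a) (hW a) (abs_nonneg _) (by positivity)
  have hnum : |∑ a, (Y a - μ) * (Real.exp (W a) - 1 - W a) * p a| ≤ 2 * R * η ^ 2 := by
    refine abs_weighted_sum_le hp hp1 fun a => ?_
    rw [abs_mul]
    refine mul_le_mul (hYμ a) ?_ (abs_nonneg _) (by positivity)
    refine (Real.abs_exp_sub_one_sub_id_le ((hW a).trans hη)).trans ?_
    rw [← sq_abs]
    exact pow_le_pow_left₀ (abs_nonneg _) (hW a) 2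
  have hcent : ∑ a, (Y a - μ) * p a = 0 := by
    simp only [sub_mul, Finset.sum_sub_distrib, ← Finset.mul_sum, hp1, ← hμ]
    ring
  have hnum_eq : ∑ a, (Y a - μ) * (Real.exp (W a) - 1 - W a) * p a
      = (∑ a, Y a * (Real.exp (W a) * p a)) - μ * Z - c := by
    have : ∀ a, (Y a - μ) * (Real.exp (W a) - 1 - W a) * p a
        = Y a * (Real.exp (W a) * p a) - μ * (Real.exp (W a) * p a)
          - (Y a - μ) * W a * p a - (Y a - μ) * p a := fun a => by ring
    simp only [this, Finset.sum_sub_distrib, ← Finset.mul_sum]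
    simp only [hcent, hc, hZ]
    ring
  have hZpos : 0 < Z := by linarith
  rw [hcov]
  set A := ∑ a, Y a * (Real.exp (W a) * p a)
  rw [hnum_eq] at hnum
  have hform : A / Z - μ - c = ((A - μ * Z - c) - c * (Z - 1)) / Z := by
    field_simp
    ring
  rw [hform, abs_div, abs_of_pos hZpos, div_le_iff₀ hZpos]
  have h5 : |c * (Z - 1)| ≤ 4 * R * η ^ 2 := by
    rw [abs_mul]
    calc |c| * |Z - 1| ≤ (2 * R * η) * (2 * η) :=
          mul_le_mul hcR hZ1 (abs_nonneg _) (by positivity)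
      _ = _ := by ring
  have h6 := abs_sub (A - μ * Z - c) (c * (Z - 1))
  have h7 : 0 ≤ 18 * R * η ^ 2 := by positivity
  nlinarith

/-- Characteristic function bound near the origin for a bounded variable. -/
theorem norm_charFun_le_exp (hp : ∀ a, 0 ≤ p a) (hp1 : ∑ a, p a = 1) {f : α → ℝ} {K t : ℝ}
    (hf : ∀ a, |f a| ≤ K) (ht : |t| * (2 * K) ≤ π) :
    ‖∑ a, (p a : ℂ) * Complex.exp ((t * f a : ℝ) * Complex.I)‖
      ≤ Real.exp (-(2 / π ^ 2) * t ^ 2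
          * (∑ a, f a ^ 2 * p a - (∑ a, f a * p a) ^ 2)) := by
  set V := ∑ a, f a ^ 2 * p a - (∑ a, f a * p a) ^ 2 with hV
  have hexp : ∀ a, (p a : ℂ) * Complex.exp ((t * f a : ℝ) * Complex.I)
      = ((p a * Real.cos (t * f a) : ℝ) : ℂ) + ((p a * Real.sin (t * f a) : ℝ) : ℂ) * Complex.I :=
    fun a => by
      rw [Complex.exp_mul_I, ← Complex.ofReal_cos, ← Complex.ofReal_sin]
      push_cast; ring
  have hsum : ∑ a, (p a : ℂ) * Complex.exp ((t * f a : ℝ) * Complex.I)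
      = ((∑ a, p a * Real.cos (t * f a) : ℝ) : ℂ)
        + ((∑ a, p a * Real.sin (t * f a) : ℝ) : ℂ) * Complex.I := by
    simp only [hexp, Finset.sum_add_distrib, ← Finset.sum_mul]
    push_cast; rfl
  have hsq : ‖∑ a, (p a : ℂ) * Complex.exp ((t * f a : ℝ) * Complex.I)‖ ^ 2
      = ∑ a, ∑ b, p a * p b * Real.cos (t * (f a - f b)) := by
    rw [hsum, ← Complex.normSq_eq_norm_sq, Complex.normSq_add_mul_I, sq, sq,
      Finset.sum_mul_sum, Finset.sum_mul_sum, ← Finset.sum_add_distrib]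
    refine Finset.sum_congr rfl fun a _ => ?_
    rw [← Finset.sum_add_distrib]
    refine Finset.sum_congr rfl fun b _ => ?_
    rw [mul_sub, Real.cos_sub]; ring
  have hle : ∑ a, ∑ b, p a * p b * Real.cos (t * (f a - f b))
      ≤ ∑ a, ∑ b, p a * p b * (1 - 2 / π ^ 2 * (t * (f a - f b)) ^ 2) := by
    refine Finset.sum_le_sum fun a _ => Finset.sum_le_sum fun b _ =>
      mul_le_mul_of_nonneg_left ?_ (mul_nonneg (hp a) (hp b))
    refine Real.cos_le_one_sub_mul_cos_sq ?_
    rw [abs_mul]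
    refine le_trans (mul_le_mul_of_nonneg_left ?_ (abs_nonneg t)) ht
    linarith [abs_sub (f a) (f b), hf a, hf b]
  have heq : ∑ a, ∑ b, p a * p b * (1 - 2 / π ^ 2 * (t * (f a - f b)) ^ 2)
      = 1 - 4 / π ^ 2 * t ^ 2 * V := by
    have hab : ∀ a b, p a * p b * (1 - 2 / π ^ 2 * (t * (f a - f b)) ^ 2)
        = p a * p b - 2 / π ^ 2 * t ^ 2 * ((f a ^ 2 * p a) * p b)
          - 2 / π ^ 2 * t ^ 2 * (p a * (f b ^ 2 * p b))
          + 4 / π ^ 2 * t ^ 2 * ((f a * p a) * (f b * p b)) := fun a b => by ring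
    simp only [hab, Finset.sum_add_distrib, Finset.sum_sub_distrib, ← Finset.mul_sum,
      ← Finset.sum_mul, hp1, hV]
    ring
  have hfin : ‖∑ a, (p a : ℂ) * Complex.exp ((t * f a : ℝ) * Complex.I)‖ ^ 2
      ≤ Real.exp (-(2 / π ^ 2) * t ^ 2 * V) ^ 2 := by
    rw [hsq, ← Real.exp_nat_mul]
    refine (hle.trans heq.le).trans ?_
    refine le_trans (le_of_eq ?_) (Real.add_one_le_exp _)
    push_cast; ring
  exact (pow_le_pow_iff_left₀ (norm_nonneg _) (Real.exp_pos _).le two_ne_zero).1 hfin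

end FiniteProbability

section ExponentialFamily

variable {α ι : Type*} [Fintype α] [Fintype ι]

/-- Partition function of the finite exponential family with sufficient statistic `y`. -/
def expZ (y : α → ι → ℝ) (θ : ι → ℝ) : ℝ := ∑ a, Real.exp (θ ⬝ᵥ y a)

/-- Probability mass function of the finite exponential family with sufficient statistic `y`. -/
def expP (y : α → ι → ℝ) (θ : ι → ℝ) (a : α) : ℝ := Real.exp (θ ⬝ᵥ y a) / expZ y θ

/-- Expectation in the finite exponential family with sufficient statistic `y`. -/
def expE (y : α → ι → ℝ) (θ : ι → ℝ) (f : α → ℝ) : ℝ := ∑ a, f a * expP y θ a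

/-- Covariance in the finite exponential family with sufficient statistic `y`. -/
def expCov (y : α → ι → ℝ) (θ : ι → ℝ) (f g : α → ℝ) : ℝ :=
  expE y θ (fun a => f a * g a) - expE y θ f * expE y θ g

variable (y : α → ι → ℝ) (θ θ' : ι → ℝ)

theorem expZ_pos [Nonempty α] : 0 < expZ y θ :=
  Finset.sum_pos (fun _ _ => Real.exp_pos _) Finset.univ_nonempty

theorem expP_nonneg (a : α) : 0 ≤ expP y θ a :=
  div_nonneg (Real.exp_pos _).le (Finset.sum_nonneg fun _ _ => (Real.exp_pos _).le)

theorem sum_expP [Nonempty α] : ∑ a, expP y θ a = 1 := by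
  simp only [expP, ← Finset.sum_div]
  exact div_self (expZ_pos y θ).ne'

theorem expE_mono {f g : α → ℝ} (h : ∀ a, f a ≤ g a) : expE y θ f ≤ expE y θ g :=
  Finset.sum_le_sum fun a _ => mul_le_mul_of_nonneg_right (h a) (expP_nonneg y θ a)

theorem expE_sum {κ : Type*} (s : Finset κ) (f : κ → α → ℝ) :
    expE y θ (fun a => ∑ k ∈ s, f k a) = ∑ k ∈ s, expE y θ (f k) := by
  simp only [expE, Finset.sum_mul]
  exact Finset.sum_comm

theorem expE_const_mul (c : ℝ) (f : α → ℝ) :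
    expE y θ (fun a => c * f a) = c * expE y θ f := by
  simp only [expE, Finset.mul_sum, mul_assoc]

theorem expE_sub (f g : α → ℝ) :
    expE y θ (fun a => f a - g a) = expE y θ f - expE y θ g := by
  simp only [expE, sub_mul, Finset.sum_sub_distrib]

theorem expE_const [Nonempty α] (c : ℝ) : expE y θ (fun _ => c) = c := by
  simp only [expE, ← Finset.mul_sum, sum_expP, mul_one]

theorem expE_sq_sub_mean [Nonempty α] (f : α → ℝ) :
    expE y θ (fun a => (f a - expE y θ f) ^ 2) = expCov y θ f f := by
  have : (fun a => (f a - expE y θ f) ^ 2)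
      = fun a => f a * f a - 2 * expE y θ f * f a - -(expE y θ f ^ 2) := by ext a; ring
  rw [this, expE_sub, expE_sub, expE_const_mul, expE_const, expCov]
  ring

theorem expCov_self_nonneg [Nonempty α] (f : α → ℝ) : 0 ≤ expCov y θ f f := by
  rw [← expE_sq_sub_mean]
  exact Finset.sum_nonneg fun a _ => mul_nonneg (sq_nonneg _) (expP_nonneg y θ a)

theorem expCov_sum_right {κ : Type*} (s : Finset κ) (f : α → ℝ) (g : κ → α → ℝ) (c : κ → ℝ) :
    expCov y θ f (fun a => ∑ k ∈ s, c k * g k a) = ∑ k ∈ s, c k * expCov y θ f (g k) := by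
  simp only [expCov, Finset.mul_sum, expE_sum, expE_const_mul, mul_sub, Finset.sum_sub_distrib]
  congr 1
  · refine Finset.sum_congr rfl fun k _ => ?_
    rw [← expE_const_mul]
    congr 1; ext a; ring
  · exact Finset.sum_congr rfl fun k _ => by ring

theorem expCov_comm (f g : α → ℝ) : expCov y θ f g = expCov y θ g f := by
  simp only [expCov, mul_comm]

theorem abs_expCov_le [Nonempty α] {f g : α → ℝ} {R S : ℝ} (hf : ∀ a, |f a| ≤ R)
    (hg : ∀ a, |g a| ≤ S) : |expCov y θ f g| ≤ 2 * R * S := by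
  have hp := expP_nonneg y θ
  have hp1 := sum_expP y θ
  obtain ⟨a0⟩ := ‹Nonempty α›
  have hR := (abs_nonneg _).trans (hf a0)
  have h1 : |expE y θ (fun a => f a * g a)| ≤ R * S :=
    abs_weighted_sum_le hp hp1 fun a => by
      rw [abs_mul]; exact mul_le_mul (hf a) (hg a) (abs_nonneg _) hR
  have h2 : |expE y θ f| ≤ R := abs_weighted_sum_le hp hp1 hf
  have h3 : |expE y θ g| ≤ S := abs_weighted_sum_le hp hp1 hg
  have h4 : |expE y θ f * expE y θ g| ≤ R * S := by
    rw [abs_mul]; exact mul_le_mul h2 h3 (abs_nonneg _) hR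
  have := abs_sub (expE y θ (fun a => f a * g a)) (expE y θ f * expE y θ g)
  rw [expCov]; linarith

theorem expZ_eq_mul [Nonempty α] :
    expZ y θ = expZ y θ' * ∑ a, Real.exp ((θ - θ') ⬝ᵥ y a) * expP y θ' a := by
  rw [Finset.mul_sum]
  refine Finset.sum_congr rfl fun a _ => ?_
  have := (expZ_pos y θ').ne'
  rw [expP, sub_dotProduct, Real.exp_sub]
  field_simp

theorem expP_eq_tilt [Nonempty α] (a : α) :
    expP y θ a = Real.exp ((θ - θ') ⬝ᵥ y a) * expP y θ' a
      / ∑ b, Real.exp ((θ - θ') ⬝ᵥ y b) * expP y θ' b := by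
  have h := expZ_eq_mul y θ θ'
  have h0 := (expZ_pos y θ').ne'
  have h1 := (expZ_pos y θ).ne'
  have h2 : ∑ b, Real.exp ((θ - θ') ⬝ᵥ y b) * expP y θ' b = expZ y θ / expZ y θ' := by
    rw [h]; field_simp
  rw [h2, expP, expP, sub_dotProduct, Real.exp_sub]
  field_simp

theorem log_expZ_sub [Nonempty α] :
    Real.log (expZ y θ) - Real.log (expZ y θ')
      = Real.log (∑ a, Real.exp ((θ - θ') ⬝ᵥ y a) * expP y θ' a) := by
  have h := expZ_eq_mul y θ θ'
  have h0 := expZ_pos y θ'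
  have h1 := expZ_pos y θ
  have hpos : 0 < ∑ a, Real.exp ((θ - θ') ⬝ᵥ y a) * expP y θ' a := by
    by_contra hn
    rw [h] at h1
    nlinarith
  rw [h, Real.log_mul h0.ne' hpos.ne']
  ring

/-- The log-partition function lies above its tangent at `θ'`. -/
theorem tangent_le_log_expZ_sub [Nonempty α] :
    expE y θ' (fun a => (θ - θ') ⬝ᵥ y a)
      ≤ Real.log (expZ y θ) - Real.log (expZ y θ') := by
  rw [log_expZ_sub]
  set μ := expE y θ' (fun a => (θ - θ') ⬝ᵥ y a) with hμ
  have h : Real.exp μ ≤ ∑ a, Real.exp ((θ - θ') ⬝ᵥ y a) * expP y θ' a := by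
    have h1 : Real.exp μ = ∑ a, (Real.exp μ * ((θ - θ') ⬝ᵥ y a - μ + 1)) * expP y θ' a := by
      simp only [mul_assoc, ← Finset.mul_sum, add_mul, sub_mul, Finset.sum_add_distrib,
        Finset.sum_sub_distrib, one_mul, sum_expP]
      have : ∑ a, (θ - θ') ⬝ᵥ y a * expP y θ' a = μ := rfl
      rw [this]; ring
    rw [h1]
    refine Finset.sum_le_sum fun a _ => mul_le_mul_of_nonneg_right ?_ (expP_nonneg y θ' a)
    have h2 := Real.add_one_le_exp ((θ - θ') ⬝ᵥ y a - μ)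
    calc Real.exp μ * ((θ - θ') ⬝ᵥ y a - μ + 1)
        ≤ Real.exp μ * Real.exp ((θ - θ') ⬝ᵥ y a - μ) :=
          mul_le_mul_of_nonneg_left h2 (Real.exp_pos _).le
      _ = Real.exp ((θ - θ') ⬝ᵥ y a) := by rw [← Real.exp_add]; congr 1; ring
  exact (Real.le_log_iff_exp_le ((Real.exp_pos _).trans_le h)).2 h

theorem tangent_add_variance_le_log_expZ_sub [Nonempty α] {K : ℝ} (hK : 2 ≤ K)
    (hb : ∀ a, |(θ - θ') ⬝ᵥ y a| ≤ K / 2) :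
    expE y θ' (fun a => (θ - θ') ⬝ᵥ y a)
        + expCov y θ' (fun a => (θ - θ') ⬝ᵥ y a) (fun a => (θ - θ') ⬝ᵥ y a) / (2 * K ^ 2)
      ≤ Real.log (expZ y θ) - Real.log (expZ y θ') := by
  rw [log_expZ_sub]
  set f : α → ℝ := fun a => (θ - θ') ⬝ᵥ y a with hf
  have hp := expP_nonneg y θ'
  have hp1 := sum_expP y θ'
  have hμ : |expE y θ' f| ≤ K / 2 := abs_weighted_sum_le hp hp1 hb
  have h := variance_le_log_sum_exp hp hp1 (f := fun a => f a - expE y θ' f) hK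
    (fun a => by linarith [abs_sub (f a) (expE y θ' f), hb a])
    (by
      have : expE y θ' (fun a => f a - expE y θ' f) = 0 := by
        rw [expE_sub, expE_const, sub_self]
      exact this)
  have h2 : ∑ a, Real.exp (f a - expE y θ' f) * expP y θ' a
      = Real.exp (-expE y θ' f) * ∑ a, Real.exp (f a) * expP y θ' a := by
    rw [Finset.mul_sum]
    refine Finset.sum_congr rfl fun a _ => ?_
    rw [sub_eq_neg_add, Real.exp_add]; ring
  have hpos : 0 < ∑ a, Real.exp (f a) * expP y θ' a := by
    have h3 := expZ_eq_mul y θ θ'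
    have h0 := expZ_pos y θ'
    have h1 := expZ_pos y θ
    by_contra hn
    rw [h3] at h1
    nlinarith
  rw [h2, Real.log_mul (Real.exp_pos _).ne' hpos.ne', Real.log_exp] at h
  have h4 : ∑ a, (f a - expE y θ' f) ^ 2 * expP y θ' a = expCov y θ' f f :=
    expE_sq_sub_mean y θ' f
  rw [h4] at h
  linarith

theorem abs_expE_sub_expE_sub_expCov_le [Nonempty α] {f : α → ℝ} {R η : ℝ} (hη : η ≤ 1)
    (hf : ∀ a, |f a| ≤ R) (hb : ∀ a, |(θ - θ') ⬝ᵥ y a| ≤ η) :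
    |expE y θ f - expE y θ' f - expCov y θ' f (fun a => (θ - θ') ⬝ᵥ y a)|
      ≤ 18 * R * η ^ 2 := by
  have h := abs_tilted_mean_sub_le (expP_nonneg y θ') (sum_expP y θ') hη hf hb
  have h1 : expE y θ f = (∑ a, f a * (Real.exp ((θ - θ') ⬝ᵥ y a) * expP y θ' a))
      / ∑ a, Real.exp ((θ - θ') ⬝ᵥ y a) * expP y θ' a := by
    rw [expE, Finset.sum_div]
    exact Finset.sum_congr rfl fun a _ => by
      rw [expP_eq_tilt y θ θ']
      ring
  rw [h1]
  exact h

end ExponentialFamily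

section ProductFamily

variable {D Ω ι : Type*} [Fintype D] [Fintype ι]

/-- The total statistic of a product of finite exponential families. -/
def sumStat (Y : D → Ω → ι → ℝ) (ω : D → Ω) : ι → ℝ := fun i => ∑ q, Y q (ω q) i

variable (Y : D → Ω → ι → ℝ) (θ : ι → ℝ)

theorem dotProduct_sumStat (ω : D → Ω) : θ ⬝ᵥ sumStat Y ω = ∑ q, θ ⬝ᵥ Y q (ω q) := by
  simp only [dotProduct, sumStat, Finset.mul_sum]
  exact Finset.sum_comm

variable [DecidableEq D] [Fintype Ω]

theorem expZ_sumStat : expZ (sumStat Y) θ = ∏ q, expZ (Y q) θ := by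
  simp only [expZ, dotProduct_sumStat, Real.exp_sum, Fintype.prod_sum]

theorem expP_sumStat (ω : D → Ω) : expP (sumStat Y) θ ω = ∏ q, expP (Y q) θ (ω q) := by
  simp only [expP, expZ_sumStat, dotProduct_sumStat, Real.exp_sum, Finset.prod_div_distrib]

theorem expE_sumStat_prod (h : D → Ω → ℝ) :
    expE (sumStat Y) θ (fun ω => ∏ q, h q (ω q)) = ∏ q, expE (Y q) θ (h q) := by
  simp only [expE, expP_sumStat, ← Finset.prod_mul_distrib, Fintype.prod_sum]

variable [Nonempty Ω]

theorem expE_sumStat_apply (q₀ : D) (f : Ω → ℝ) :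
    expE (sumStat Y) θ (fun ω => f (ω q₀)) = expE (Y q₀) θ f := by
  have h := expE_sumStat_prod Y θ (fun q a => if q = q₀ then f a else 1)
  have h1 : ∀ q, expE (Y q) θ (fun a => if q = q₀ then f a else 1)
      = if q = q₀ then expE (Y q) θ f else 1 := fun q => by
    by_cases hq : q = q₀
    · simp only [hq, if_true]
    · simp only [hq, if_false, expE_const]
  simp only [h1, Finset.prod_ite_eq', Finset.mem_univ, if_true] at h
  exact h

theorem expE_sumStat_apply_mul {q₀ q₁ : D} (hne : q₀ ≠ q₁) (f g : Ω → ℝ) :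
    expE (sumStat Y) θ (fun ω => f (ω q₀) * g (ω q₁))
      = expE (Y q₀) θ f * expE (Y q₁) θ g := by
  have h := expE_sumStat_prod Y θ
    (fun q a => (if q = q₀ then f a else 1) * (if q = q₁ then g a else 1))
  have h1 : ∀ q, expE (Y q) θ
        (fun a => (if q = q₀ then f a else 1) * (if q = q₁ then g a else 1))
      = (if q = q₀ then expE (Y q) θ f else 1) * (if q = q₁ then expE (Y q) θ g else 1) :=
    fun q => by
      by_cases hq : q = q₀
      · subst hq
        simp only [if_true, hne, if_false, mul_one]
      · by_cases hq' : q = q₁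
        · simp only [hq', if_true, if_false, one_mul, hne.symm]
        · simp only [hq, hq', if_false, mul_one, expE_const]
  simp only [h1, Finset.prod_mul_distrib, Finset.prod_ite_eq', Finset.mem_univ, if_true] at h
  exact h

theorem expCov_sumStat (f g : D → Ω → ℝ) :
    expCov (sumStat Y) θ (fun ω => ∑ q, f q (ω q)) (fun ω => ∑ q, g q (ω q))
      = ∑ q, expCov (Y q) θ (f q) (g q) := by
  simp only [expCov, Finset.sum_mul_sum, expE_sum]
  rw [← Finset.sum_sub_distrib]
  refine Finset.sum_congr rfl fun q _ => ?_
  rw [← Finset.sum_sub_distrib, Finset.sum_eq_single q]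
  · rw [expE_sumStat_apply Y θ q (fun a => f q a * g q a), expE_sumStat_apply Y θ q (f q),
      expE_sumStat_apply Y θ q (g q)]
  · intro q' _ hq'
    rw [expE_sumStat_apply_mul Y θ hq'.symm, expE_sumStat_apply Y θ q (f q),
      expE_sumStat_apply Y θ q' (g q'), sub_self]
  · simp

theorem expE_sumStat_sum (f : D → Ω → ℝ) :
    expE (sumStat Y) θ (fun ω => ∑ q, f q (ω q)) = ∑ q, expE (Y q) θ (f q) := by
  rw [expE_sum]
  exact Finset.sum_congr rfl fun q _ => expE_sumStat_apply Y θ q (f q)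

theorem tangent_add_variance_le_log_expZ_sumStat_sub (θ' : ι → ℝ) {K : ℝ} (hK : 2 ≤ K)
    (hb : ∀ q a, |(θ - θ') ⬝ᵥ Y q a| ≤ K / 2) :
    expE (sumStat Y) θ' (fun ω => (θ - θ') ⬝ᵥ sumStat Y ω)
        + expCov (sumStat Y) θ' (fun ω => (θ - θ') ⬝ᵥ sumStat Y ω)
            (fun ω => (θ - θ') ⬝ᵥ sumStat Y ω) / (2 * K ^ 2)
      ≤ Real.log (expZ (sumStat Y) θ) - Real.log (expZ (sumStat Y) θ') := by
  simp only [dotProduct_sumStat]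
  rw [expE_sumStat_sum Y θ' (fun q a => (θ - θ') ⬝ᵥ Y q a),
    expCov_sumStat Y θ' (fun q a => (θ - θ') ⬝ᵥ Y q a) (fun q a => (θ - θ') ⬝ᵥ Y q a),
    expZ_sumStat, expZ_sumStat, Real.log_prod fun q _ => (expZ_pos (Y q) θ).ne',
    Real.log_prod fun q _ => (expZ_pos (Y q) θ').ne', ← Finset.sum_sub_distrib, Finset.sum_div,
    ← Finset.sum_add_distrib]
  exact Finset.sum_le_sum fun q _ => tangent_add_variance_le_log_expZ_sub (Y q) θ θ' hK (hb q)

theorem abs_expE_sumStat_sub_le (θ' : ι → ℝ) (l : ι) {R η : ℝ} (hη : η ≤ 1)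
    (hR : ∀ q a, |Y q a l| ≤ R) (hb : ∀ q a, |(θ - θ') ⬝ᵥ Y q a| ≤ η) :
    |expE (sumStat Y) θ (fun ω => sumStat Y ω l) - expE (sumStat Y) θ' (fun ω => sumStat Y ω l)
        - expCov (sumStat Y) θ' (fun ω => sumStat Y ω l) (fun ω => (θ - θ') ⬝ᵥ sumStat Y ω)|
      ≤ Fintype.card D * (18 * R * η ^ 2) := by
  simp only [dotProduct_sumStat]
  have h1 : ∀ θ, expE (sumStat Y) θ (fun ω => sumStat Y ω l)
      = ∑ q, expE (Y q) θ (fun a => Y q a l) := fun θ =>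
    expE_sumStat_sum Y θ (fun q a => Y q a l)
  have h2 : expCov (sumStat Y) θ' (fun ω => sumStat Y ω l)
        (fun ω => ∑ q, (θ - θ') ⬝ᵥ Y q (ω q))
      = ∑ q, expCov (Y q) θ' (fun a => Y q a l) (fun a => (θ - θ') ⬝ᵥ Y q a) :=
    expCov_sumStat Y θ' (fun q a => Y q a l) (fun q a => (θ - θ') ⬝ᵥ Y q a)
  rw [h1, h1, h2, ← Finset.sum_sub_distrib, ← Finset.sum_sub_distrib]
  refine (Finset.abs_sum_le_sum_abs _ _).trans ?_
  refine (Finset.sum_le_sum fun q _ =>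
    abs_expE_sub_expE_sub_expCov_le (Y q) θ θ' hη (hR q) (hb q)).trans ?_
  simp

theorem abs_expCov_sumStat_le {k l : ι} {R : ℝ} (hk : ∀ q a, |Y q a k| ≤ R)
    (hl : ∀ q a, |Y q a l| ≤ R) :
    |expCov (sumStat Y) θ (fun ω => sumStat Y ω k) (fun ω => sumStat Y ω l)|
      ≤ Fintype.card D * (2 * R * R) := by
  have h := expCov_sumStat Y θ (fun q a => Y q a k) (fun q a => Y q a l)
  have h' : expCov (sumStat Y) θ (fun ω => sumStat Y ω k) (fun ω => sumStat Y ω l)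
      = ∑ q, expCov (Y q) θ (fun a => Y q a k) (fun a => Y q a l) := h
  rw [h']
  refine (Finset.abs_sum_le_sum_abs _ _).trans ?_
  refine (Finset.sum_le_sum fun q _ => abs_expCov_le (Y q) θ (hk q) (hl q)).trans ?_
  simp

theorem norm_charFun_sumStat_le (f : D → Ω → ℝ) {K t : ℝ} (hf : ∀ q a, |f q a| ≤ K)
    (ht : |t| * (2 * K) ≤ π) :
    ‖∑ ω, (expP (sumStat Y) θ ω : ℂ) * Complex.exp ((t * ∑ q, f q (ω q) : ℝ) * Complex.I)‖
      ≤ Real.exp (-(2 / π ^ 2) * t ^ 2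
          * expCov (sumStat Y) θ (fun ω => ∑ q, f q (ω q)) (fun ω => ∑ q, f q (ω q))) := by
  have h1 : ∑ ω, (expP (sumStat Y) θ ω : ℂ)
        * Complex.exp ((t * ∑ q, f q (ω q) : ℝ) * Complex.I)
      = ∏ q, ∑ a, (expP (Y q) θ a : ℂ) * Complex.exp ((t * f q a : ℝ) * Complex.I) := by
    rw [Fintype.prod_sum]
    refine Finset.sum_congr rfl fun ω _ => ?_
    rw [expP_sumStat, Finset.prod_mul_distrib, ← Complex.exp_sum]
    push_cast
    rw [Finset.mul_sum, Finset.sum_mul]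
  rw [h1, norm_prod, expCov_sumStat, Finset.mul_sum, Real.exp_sum]
  refine Finset.prod_le_prod (fun _ _ => norm_nonneg _) fun q _ => ?_
  refine (norm_charFun_le_exp (expP_nonneg (Y q) θ) (sum_expP (Y q) θ) (hf q) ht).trans
    (le_of_eq ?_)
  simp only [expCov, expE, sq]

theorem expE_cos_sumStat_le (f : D → Ω → ℝ) {K t : ℝ} (μ : ℝ) (hf : ∀ q a, |f q a| ≤ K)
    (ht : |t| * (2 * K) ≤ π) :
    expE (sumStat Y) θ (fun ω => Real.cos (t * (∑ q, f q (ω q) - μ)))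
      ≤ Real.exp (-(2 / π ^ 2) * t ^ 2
          * expCov (sumStat Y) θ (fun ω => ∑ q, f q (ω q)) (fun ω => ∑ q, f q (ω q))) := by
  refine le_trans ?_ (norm_charFun_sumStat_le Y θ f hf ht)
  set z := ∑ ω, (expP (sumStat Y) θ ω : ℂ)
    * Complex.exp ((t * ∑ q, f q (ω q) : ℝ) * Complex.I) with hz
  have h1 : ‖Complex.exp ((-(t * μ) : ℝ) * Complex.I) * z‖ = ‖z‖ := by
    rw [norm_mul, Complex.norm_exp_ofReal_mul_I, one_mul]
  rw [← h1]
  refine le_trans (le_of_eq ?_) (Complex.re_le_norm _)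
  rw [hz, Finset.mul_sum, Complex.re_sum, expE]
  refine Finset.sum_congr rfl fun ω _ => ?_
  rw [mul_left_comm, ← Complex.exp_add, ← add_mul, ← Complex.ofReal_add, Complex.re_ofReal_mul,
    Complex.exp_ofReal_mul_I_re, mul_comm]
  congr 2
  ring

theorem double_sum_cos_sub_eq (J : ℕ) (z : ℝ) :
    ∑ j ∈ range J, ∑ l ∈ range J, Real.cos (((j : ℝ) - l) * z)
      = (∑ j ∈ range J, Real.cos (j * z)) ^ 2 + (∑ j ∈ range J, Real.sin (j * z)) ^ 2 := by
  rw [sq, sq, Finset.sum_mul_sum, Finset.sum_mul_sum, ← Finset.sum_add_distrib]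
  refine Finset.sum_congr rfl fun j _ => ?_
  rw [← Finset.sum_add_distrib]
  refine Finset.sum_congr rfl fun l _ => ?_
  rw [sub_mul, Real.cos_sub]

theorem sq_le_four_mul_double_sum_cos {J : ℕ} {z : ℝ} (hz : J * |z| ≤ 1) :
    (J : ℝ) ^ 2 ≤ 4 * ∑ j ∈ range J, ∑ l ∈ range J, Real.cos (((j : ℝ) - l) * z) := by
  rw [double_sum_cos_sub_eq]
  have h : (J : ℝ) / 2 ≤ ∑ j ∈ range J, Real.cos (j * z) := by
    have : (J : ℝ) / 2 = ∑ j ∈ range J, (1 / 2 : ℝ) := by simp; ring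
    rw [this]
    refine Finset.sum_le_sum fun j hj => ?_
    have hjJ : (j : ℝ) ≤ J := by exact_mod_cast (Finset.mem_range.1 hj).le
    have h1 : |(j : ℝ) * z| ≤ 1 := by
      rw [abs_mul, Nat.abs_cast]
      exact (mul_le_mul_of_nonneg_right hjJ (abs_nonneg z)).trans hz
    have h2 : ((j : ℝ) * z) ^ 2 ≤ 1 := by rw [← sq_abs]; exact pow_le_one₀ (abs_nonneg _) h1
    linarith [Real.one_sub_sq_div_two_le_cos (x := (j : ℝ) * z)]
  have hJ : (0 : ℝ) ≤ J := Nat.cast_nonneg J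
  nlinarith [sq_nonneg (∑ j ∈ range J, Real.sin (j * z))]

/-- Anticoncentration of a sum of independent bounded variables. -/
theorem expE_indicator_sumStat_le (f : D → Ω → ℝ) {K h τ : ℝ} (μ : ℝ) {J : ℕ} (hJ : 0 < J)
    (hh : 0 ≤ h) (hK : 0 ≤ K) (hf : ∀ q a, |f q a| ≤ K) (hJK : J * h * (2 * K) ≤ π)
    (hJτ : J * h * τ ≤ 1) :
    expE (sumStat Y) θ (fun ω => if |∑ q, f q (ω q) - μ| ≤ τ then 1 else 0)
      ≤ 4 / J + 4 * Real.exp (-(2 / π ^ 2) * h ^ 2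
          * expCov (sumStat Y) θ (fun ω => ∑ q, f q (ω q)) (fun ω => ∑ q, f q (ω q))) := by
  set V := expCov (sumStat Y) θ (fun ω => ∑ q, f q (ω q)) (fun ω => ∑ q, f q (ω q)) with hV
  have hV0 : 0 ≤ V := expCov_self_nonneg _ _ _
  set B := Real.exp (-(2 / π ^ 2) * h ^ 2 * V) with hB
  have hJ' : (0 : ℝ) < J := by exact_mod_cast hJ
  have hpt : ∀ ω : D → Ω, (if |∑ q, f q (ω q) - μ| ≤ τ then (1 : ℝ) else 0)
      ≤ 4 / (J : ℝ) ^ 2 * ∑ j ∈ range J, ∑ l ∈ range J,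
        Real.cos ((((j : ℝ) - l) * h) * (∑ q, f q (ω q) - μ)) := fun ω => by
    simp only [mul_assoc _ h]
    split_ifs with hω
    · have h1 : (J : ℝ) * |h * (∑ q, f q (ω q) - μ)| ≤ 1 := by
        rw [abs_mul, abs_of_nonneg hh, ← mul_assoc]
        exact (mul_le_mul_of_nonneg_left hω (by positivity)).trans hJτ
      have h2 := sq_le_four_mul_double_sum_cos h1
      rw [div_mul_eq_mul_div, le_div_iff₀ (by positivity), one_mul]
      exact h2
    · rw [double_sum_cos_sub_eq]
      positivity
  refine (expE_mono _ θ hpt).trans ?_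
  rw [expE_const_mul, expE_sum]
  simp only [expE_sum]
  have hterm : ∀ j ∈ range J, ∀ l ∈ range J,
      expE (sumStat Y) θ (fun ω => Real.cos ((((j : ℝ) - l) * h) * (∑ q, f q (ω q) - μ)))
        ≤ (if j = l then 1 else 0) + B := by
    intro j hj l hl
    have hj' : (j : ℝ) ≤ J := by exact_mod_cast (Finset.mem_range.1 hj).le
    have hl' : (l : ℝ) ≤ J := by exact_mod_cast (Finset.mem_range.1 hl).le
    have hj0 : (0 : ℝ) ≤ j := Nat.cast_nonneg j
    have hl0 : (0 : ℝ) ≤ l := Nat.cast_nonneg l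
    have hB0 : 0 < B := Real.exp_pos _
    split_ifs with hjl
    · subst hjl
      simp only [sub_self, zero_mul, Real.cos_zero, expE_const]
      linarith
    · have habs : |(j : ℝ) - l| ≤ J := abs_le.2 ⟨by linarith, by linarith⟩
      refine (expE_cos_sumStat_le Y θ f (K := K) μ hf ?_).trans ?_
      · refine le_trans ?_ hJK
        rw [abs_mul, abs_of_nonneg hh]
        gcongr
      · rw [zero_add, hB]
        refine Real.exp_le_exp.2 ?_
        have hone : (1 : ℝ) ≤ ((j : ℝ) - l) ^ 2 := by
          have : (1 : ℤ) ≤ ((j : ℤ) - l) ^ 2 := by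
            have : ((j : ℤ) - l) ≠ 0 := by omega
            have := sq_pos_of_ne_zero this
            omega
          exact_mod_cast this
        have h3 : h ^ 2 ≤ (((j : ℝ) - l) * h) ^ 2 := by
          rw [mul_pow]; nlinarith [sq_nonneg h]
        have h4 : 0 ≤ 2 / π ^ 2 * V := by positivity
        nlinarith [mul_le_mul_of_nonneg_left h3 h4]
  calc 4 / (J : ℝ) ^ 2 * ∑ j ∈ range J, ∑ l ∈ range J,
        expE (sumStat Y) θ (fun ω => Real.cos ((((j : ℝ) - l) * h) * (∑ q, f q (ω q) - μ)))
      ≤ 4 / (J : ℝ) ^ 2 * ∑ j ∈ range J, ∑ l ∈ range J, ((if j = l then 1 else 0) + B) := by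
        refine mul_le_mul_of_nonneg_left ?_ (by positivity)
        exact Finset.sum_le_sum fun j hj => Finset.sum_le_sum fun l hl => hterm j hj l hl
    _ = 4 / J + 4 * B := by
        have : ∀ j ∈ range J, ∑ l ∈ range J, ((if j = l then (1 : ℝ) else 0) + B)
            = 1 + J * B := fun j hj => by
          rw [Finset.sum_add_distrib, Finset.sum_ite_eq, if_pos hj]
          simp
        rw [Finset.sum_congr rfl this]
        simp only [Finset.sum_const, Finset.card_range, nsmul_eq_mul]
        field_simp

end ProductFamily

section Network

/-- The dyads of a network on `n` nodes. -/
abbrev Dyad (n : ℕ) := {q : Fin n × Fin n // q.1 < q.2}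

/-- The contribution of a dyad in state `a` to the sufficient statistic. -/
def dyadStat (n m : ℕ) (v : Fin n → Fin m → E) (w : E → E → ℝ) (g : E → ℝ)
    (q : Dyad n) (a : Bool × Bool) : Idx m → ℝ
  | Sum.inl i => if i = 0 then bval a.1 * bval a.2 else bval a.1 + bval a.2
  | Sum.inr (Sum.inl k) =>
      bval a.1 * w (v q.1.1 k) (v q.1.2 k) + bval a.2 * w (v q.1.2 k) (v q.1.1 k)
  | Sum.inr (Sum.inr (Sum.inl k)) => bval a.1 * g (v q.1.1 k) + bval a.2 * g (v q.1.2 k)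
  | Sum.inr (Sum.inr (Sum.inr k)) => bval a.1 * g (v q.1.2 k) + bval a.2 * g (v q.1.1 k)

/-- The states of all dyads of a network. -/
def dyadConfig {n : ℕ} (x : Fin n → Fin n → Bool) (q : Dyad n) : Bool × Bool :=
  (x q.1.1 q.1.2, x q.1.2 q.1.1)

theorem sum_pairsLT {n : ℕ} (f : Fin n × Fin n → ℝ) :
    ∑ q ∈ pairsLT n, f q = ∑ q : Dyad n, f q.1 :=
  Finset.sum_subtype _ (fun q => by simp [pairsLT]) f

theorem sum_pairsNE {n : ℕ} (f : Fin n × Fin n → ℝ) :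
    ∑ q ∈ pairsNE n, f q = ∑ q : Dyad n, (f q.1 + f q.1.swap) := by
  rw [Finset.sum_add_distrib, ← sum_pairsLT, ← sum_pairsLT (fun q => f q.swap)]
  have h1 : pairsNE n = pairsLT n ∪ (pairsLT n).image Prod.swap := by
    ext ⟨a, b⟩
    simp only [pairsNE, pairsLT, Finset.mem_union, Finset.mem_filter, Finset.mem_univ, true_and,
      Finset.mem_image, Prod.exists, Prod.swap_prod_mk, Prod.mk.injEq]
    constructor
    · intro h
      rcases lt_or_gt_of_ne h with h | h
      · exact Or.inl h
      · exact Or.inr ⟨b, a, h, rfl, rfl⟩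
    · rintro (h | ⟨c, d, h, rfl, rfl⟩)
      · exact ne_of_lt h
      · exact ne_of_gt h
  have h2 : Disjoint (pairsLT n) ((pairsLT n).image Prod.swap) := by
    rw [Finset.disjoint_left]
    rintro ⟨a, b⟩ hab hab'
    simp only [pairsLT, Finset.mem_filter, Finset.mem_univ, true_and,
      Finset.mem_image, Prod.exists, Prod.swap_prod_mk, Prod.mk.injEq] at hab hab'
    obtain ⟨c, d, h, rfl, rfl⟩ := hab'
    exact lt_asymm h hab
  rw [h1, Finset.sum_union h2, Finset.sum_image (Prod.swap_injective.injOn)]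

theorem card_dyad (n : ℕ) : Fintype.card (Dyad n) = Ndyads n := by
  have h := sum_pairsNE (n := n) (fun _ => 1)
  have h1 : (pairsNE n) = (Finset.univ : Finset (Fin n)).offDiag := by
    ext ⟨a, b⟩; simp [pairsNE]
  rw [h1] at h
  simp only [Finset.sum_const, Finset.offDiag_card, Finset.card_univ, Fintype.card_fin,
    nsmul_eq_mul, mul_one] at h
  have h2 : n * n - n = Fintype.card (Dyad n) * 2 := by
    have : ((n * n - n : ℕ) : ℝ) = ((Fintype.card (Dyad n) * 2 : ℕ) : ℝ) := by
      rw [h]; push_cast; norm_num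
    exact_mod_cast this
  have h3 : n * (n - 1) = n * n - n := by
    cases n with
    | zero => rfl
    | succ k => simp [Nat.mul_succ]
  rw [Ndyads, h3, h2, Nat.mul_div_cancel _ (by norm_num)]

variable (n m : ℕ) (v : Fin n → Fin m → E) (w : E → E → ℝ) (g : E → ℝ)

/-- The sufficient statistic as a function of the dyad states. -/
abbrev netStat : (Dyad n → Bool × Bool) → Idx m → ℝ := sumStat (dyadStat n m v w g)

theorem svec_eq_netStat (x : Fin n → Fin n → Bool) :
    svec n m v w g x = netStat n m v w g (dyadConfig x) := by
  ext i
  rcases i with i | k | k | k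
  · simp only [svec, netStat, sumStat, dyadStat, dyadConfig, sum_pairsLT, sum_pairsNE]
    split_ifs <;> rfl
  all_goals
    simp only [svec, netStat, sumStat, dyadStat, dyadConfig, sum_pairsNE, Prod.fst_swap,
      Prod.snd_swap]

variable {n} in
theorem sum_nets (G : (Dyad n → Bool × Bool) → ℝ) :
    ∑ x ∈ nets n, G (dyadConfig x) = ∑ ω, G ω := by
  refine Finset.sum_bij' (fun x _ => dyadConfig x)
    (fun ω _ a b => if h : a < b then (ω ⟨(a, b), h⟩).1
      else if h : b < a then (ω ⟨(b, a), h⟩).2 else false) (fun _ _ => Finset.mem_univ _)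
    ?_ ?_ ?_ (fun _ _ => rfl)
  · intro ω _
    simp [nets]
  · intro x hx
    simp only [nets, Finset.mem_filter, Finset.mem_univ, true_and] at hx
    funext a b
    rcases lt_trichotomy a b with h | h | h
    · simp [h, dyadConfig]
    · subst h; simp [hx]
    · simp [h, dyadConfig, not_lt.2 h.le]
  · intro ω _
    funext ⟨⟨a, b⟩, h⟩
    have h' : a < b := h
    simp [dyadConfig, h', not_lt.2 h'.le]

variable (θ θ' : Idx m → ℝ)

theorem Hvec_eq (x : Fin n → Fin n → Bool) :
    Hvec n m v w g θ x = θ ⬝ᵥ netStat n m v w g (dyadConfig x) := by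
  rw [← svec_eq_netStat]; rfl

theorem Zvec_eq : Zvec n m v w g θ = expZ (netStat n m v w g) θ := by
  simp only [Zvec, Hvec_eq]
  exact sum_nets (fun ω => Real.exp (θ ⬝ᵥ netStat n m v w g ω))

theorem Pvec_eq (x : Fin n → Fin n → Bool) :
    Pvec n m v w g θ x = expP (netStat n m v w g) θ (dyadConfig x) := by
  rw [Pvec, Hvec_eq, Zvec_eq]; rfl

theorem Emean_eq (f : (Dyad n → Bool × Bool) → ℝ) :
    Emean n m v w g θ (fun x => f (dyadConfig x)) = expE (netStat n m v w g) θ f := by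
  simp only [Emean, Pvec_eq]
  exact sum_nets (fun ω => f ω * expP (netStat n m v w g) θ ω)

theorem Emean_svec (i : Idx m) :
    Emean n m v w g θ (fun x => svec n m v w g x i)
      = expE (netStat n m v w g) θ (fun ω => netStat n m v w g ω i) := by
  simp only [svec_eq_netStat]
  exact Emean_eq n m v w g θ (fun ω => netStat n m v w g ω i)

theorem Ifish_eq (k l : Idx m) :
    Ifish n m v w g θ k l = expCov (netStat n m v w g) θ
      (fun ω => netStat n m v w g ω k) (fun ω => netStat n m v w g ω l) := by
  simp only [Ifish, Matrix.of_apply, Emean_svec, expCov]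
  congr 1
  simp only [svec_eq_netStat]
  exact Emean_eq n m v w g θ (fun ω => netStat n m v w g ω k * netStat n m v w g ω l)

theorem sum_Ifish_mul (k : Idx m) (u : Idx m → ℝ) :
    ∑ l, Ifish n m v w g θ k l * u l = expCov (netStat n m v w g) θ
      (fun ω => netStat n m v w g ω k) (fun ω => u ⬝ᵥ netStat n m v w g ω) := by
  simp only [dotProduct, expCov_sum_right, Ifish_eq, mul_comm]

theorem dotProduct_Ifish_mulVec (u : Idx m → ℝ) :
    u ⬝ᵥ (Ifish n m v w g θ).mulVec u = expCov (netStat n m v w g) θ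
      (fun ω => u ⬝ᵥ netStat n m v w g ω) (fun ω => u ⬝ᵥ netStat n m v w g ω) := by
  have h : ∀ k, (Ifish n m v w g θ).mulVec u k = expCov (netStat n m v w g) θ
      (fun ω => u ⬝ᵥ netStat n m v w g ω) (fun ω => netStat n m v w g ω k) := fun k => by
    rw [expCov_comm, ← sum_Ifish_mul]; rfl
  rw [dotProduct]
  simp only [h]
  rw [← expCov_sum_right]
  rfl

theorem expE_dotProduct_netStat (u : Idx m → ℝ) :
    expE (netStat n m v w g) θ (fun ω => u ⬝ᵥ netStat n m v w g ω)
      = ∑ i, u i * Emean n m v w g θ (fun x => svec n m v w g x i) := by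
  simp only [Emean_svec, dotProduct, expE_sum, expE_const_mul]

theorem Llik_sub_eq (x : Fin n → Fin n → Bool) :
    Llik n m v w g θ x - Llik n m v w g θ' x
      = ∑ i, (θ - θ') i * svec n m v w g x i
        - (Real.log (expZ (netStat n m v w g) θ) - Real.log (expZ (netStat n m v w g) θ')) := by
  simp only [Llik, Zvec_eq, Hvec, Pi.sub_apply, sub_mul, Finset.sum_sub_distrib]
  ring

theorem Llik_sub_le (x : Fin n → Fin n → Bool) :
    Llik n m v w g θ x - Llik n m v w g θ' x
      ≤ ∑ i, (θ - θ') i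
        * (svec n m v w g x i - Emean n m v w g θ' (fun x => svec n m v w g x i)) := by
  have h := tangent_le_log_expZ_sub (netStat n m v w g) θ θ'
  rw [expE_dotProduct_netStat] at h
  rw [Llik_sub_eq]
  simp only [mul_sub, Finset.sum_sub_distrib]
  linarith

theorem abs_dotProduct_le {ι : Type*} [Fintype ι] {u y : ι → ℝ} {R : ℝ} (hy : ∀ i, |y i| ≤ R) :
    |u ⬝ᵥ y| ≤ Fintype.card ι * R * ‖u‖ := by
  refine (Finset.abs_sum_le_sum_abs _ _).trans ?_
  calc ∑ i, |u i * y i| ≤ ∑ i : ι, ‖u‖ * R := by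
        refine Finset.sum_le_sum fun i _ => ?_
        rw [abs_mul]
        exact mul_le_mul (norm_le_pi_norm u i) (hy i) (abs_nonneg _) (norm_nonneg _)
    _ = _ := by
        simp only [Finset.sum_const, Finset.card_univ, nsmul_eq_mul]; ring

variable {n m v w g θ θ'} {R : ℝ}

theorem Llik_sub_le_sub_quadratic (hR : ∀ q a i, |dyadStat n m v w g q a i| ≤ R)
    {K : ℝ} (hK : 2 ≤ K) (hθ : Fintype.card (Idx m) * R * ‖θ - θ'‖ ≤ K / 2)
    (x : Fin n → Fin n → Bool) :
    Llik n m v w g θ x - Llik n m v w g θ' x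
      ≤ ∑ i, (θ - θ') i
          * (svec n m v w g x i - Emean n m v w g θ' (fun x => svec n m v w g x i))
        - (θ - θ') ⬝ᵥ (Ifish n m v w g θ').mulVec (θ - θ') / (2 * K ^ 2) := by
  have h := tangent_add_variance_le_log_expZ_sumStat_sub (dyadStat n m v w g) θ θ' hK
    (fun q a => (abs_dotProduct_le (hR q a)).trans hθ)
  rw [expE_dotProduct_netStat, ← dotProduct_Ifish_mulVec] at h
  rw [Llik_sub_eq]
  simp only [mul_sub, Finset.sum_sub_distrib]
  linarith

theorem abs_Emean_sub_sub_le (hR : ∀ q a i, |dyadStat n m v w g q a i| ≤ R)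
    (hθ : Fintype.card (Idx m) * R * ‖θ - θ'‖ ≤ 1) (l : Idx m) :
    |Emean n m v w g θ (fun x => svec n m v w g x l)
        - Emean n m v w g θ' (fun x => svec n m v w g x l)
        - ∑ k, Ifish n m v w g θ' l k * (θ - θ') k|
      ≤ Ndyads n * (18 * R * (Fintype.card (Idx m) * R * ‖θ - θ'‖) ^ 2) := by
  have h := abs_expE_sumStat_sub_le (dyadStat n m v w g) θ θ' l hθ (fun q a => hR q a l)
    (fun q a => abs_dotProduct_le (hR q a))
  rw [card_dyad] at h
  rw [Emean_svec, Emean_svec, sum_Ifish_mul]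
  exact h

theorem abs_Ifish_le (hR : ∀ q a i, |dyadStat n m v w g q a i| ≤ R) (k l : Idx m) :
    |Ifish n m v w g θ k l| ≤ Ndyads n * (2 * R * R) := by
  rw [Ifish_eq, ← card_dyad]
  exact abs_expCov_sumStat_le (dyadStat n m v w g) θ (fun q a => hR q a k) (fun q a => hR q a l)

/-- The likelihood equations at an interior maximizer. -/
theorem svec_eq_Emean_of_isMaxOn {Θ : Set (Idx m → ℝ)} {x : Fin n → Fin n → Bool}
    (hθ : θ ∈ interior Θ) (hmax : ∀ θ' ∈ Θ, Llik n m v w g θ' x ≤ Llik n m v w g θ x)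
    (l : Idx m) :
    svec n m v w g x l = Emean n m v w g θ (fun x => svec n m v w g x l) := by
  set e : Idx m → ℝ := Pi.single l 1 with he
  have hH : ∀ x' : Fin n → Fin n → Bool, HasDerivAt
      (fun t : ℝ => Hvec n m v w g (θ + t • e) x') (svec n m v w g x' l) 0 := by
    intro x'
    have h1 : (fun t : ℝ => Hvec n m v w g (θ + t • e) x')
        = fun t => Hvec n m v w g θ x' + t * svec n m v w g x' l := by
      funext t
      simp only [Hvec, Pi.add_apply, Pi.smul_apply, smul_eq_mul, add_mul,
        Finset.sum_add_distrib, he, mul_assoc, ← Finset.mul_sum]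
      congr 2
      rw [Finset.sum_eq_single l] <;> simp +contextual
    rw [h1]
    simpa using ((hasDerivAt_id (0 : ℝ)).mul_const (svec n m v w g x' l)).const_add
      (Hvec n m v w g θ x')
  have h0 : θ + (0 : ℝ) • e = θ := by simp
  have hZ : HasDerivAt (fun t : ℝ => Zvec n m v w g (θ + t • e))
      (∑ x' ∈ nets n, Real.exp (Hvec n m v w g θ x') * svec n m v w g x' l) 0 := by
    have := HasDerivAt.fun_sum (u := nets n) (fun x' _ => (hH x').exp)
    simp only [h0] at this
    exact this
  have hZpos : 0 < Zvec n m v w g θ := by rw [Zvec_eq]; exact expZ_pos _ _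
  have hL : HasDerivAt (fun t : ℝ => Llik n m v w g (θ + t • e) x)
      (svec n m v w g x l - Emean n m v w g θ (fun x => svec n m v w g x l)) 0 := by
    have h2 := (hH x).sub (hZ.log (by rw [h0]; exact hZpos.ne'))
    rw [h0] at h2
    have h3 : Emean n m v w g θ (fun x => svec n m v w g x l)
        = (∑ x' ∈ nets n, Real.exp (Hvec n m v w g θ x') * svec n m v w g x' l)
          / Zvec n m v w g θ := by
      simp only [Emean, Pvec, Finset.sum_div]
      exact Finset.sum_congr rfl fun x' _ => by ring
    rw [h3]
    exact h2
  have hloc : IsLocalMax (fun t : ℝ => Llik n m v w g (θ + t • e) x) 0 := by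
    have hc : Continuous (fun t : ℝ => θ + t • e) := by fun_prop
    have hmem : ∀ᶠ t in nhds (0 : ℝ), θ + t • e ∈ interior Θ :=
      hc.continuousAt.eventually_mem (by rw [h0]; exact isOpen_interior.mem_nhds hθ)
    filter_upwards [hmem] with t ht
    rw [h0]
    exact hmax _ (interior_subset ht)
  linarith [hloc.hasDerivAt_eq_zero hL]

theorem Pr_mono {φ ψ : (Fin n → Fin n → Bool) → Prop} (h : ∀ x ∈ nets n, φ x → ψ x) :
    Pr n m v w g θ φ ≤ Pr n m v w g θ ψ := by
  refine Finset.sum_le_sum_of_subset_of_nonneg ?_ ?_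
  · intro x hx
    rw [Finset.mem_filter] at hx ⊢
    exact ⟨hx.1, h x hx.1 hx.2⟩
  · intro x _ _
    rw [Pvec_eq]; exact expP_nonneg _ _ _

theorem Pr_add_Pr_not (φ : (Fin n → Fin n → Bool) → Prop) :
    Pr n m v w g θ φ + Pr n m v w g θ (fun x => ¬ φ x) = 1 := by
  rw [Pr, Pr, Finset.sum_filter_add_sum_filter_not]
  simp only [Pvec_eq]
  rw [sum_nets (fun ω => expP (netStat n m v w g) θ ω), sum_expP]

theorem Pr_le_one (φ : (Fin n → Fin n → Bool) → Prop) : Pr n m v w g θ φ ≤ 1 := by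
  have h := Pr_add_Pr_not (v := v) (w := w) (g := g) (θ := θ) φ
  have : 0 ≤ Pr n m v w g θ (fun x => ¬ φ x) :=
    Finset.sum_nonneg fun x _ => by rw [Pvec_eq]; exact expP_nonneg _ _ _
  linarith

theorem Pr_exists_le {κ : Type*} (s : Finset κ) (φ : κ → (Fin n → Fin n → Bool) → Prop) :
    Pr n m v w g θ (fun x => ∃ k ∈ s, φ k x) ≤ ∑ k ∈ s, Pr n m v w g θ (φ k) := by
  simp only [Pr, Finset.sum_filter]
  rw [Finset.sum_comm]
  refine Finset.sum_le_sum fun x _ => ?_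
  have hP : 0 ≤ Pvec n m v w g θ x := by rw [Pvec_eq]; exact expP_nonneg _ _ _
  have hnn : ∀ k ∈ s, 0 ≤ if φ k x then Pvec n m v w g θ x else 0 := fun k _ => by
    split_ifs <;> [exact hP; exact le_rfl]
  split_ifs with h
  · obtain ⟨k, hk, hkx⟩ := h
    refine le_trans (le_of_eq ?_) (Finset.single_le_sum hnn hk)
    rw [if_pos hkx]
  · exact Finset.sum_nonneg hnn

theorem Pr_eq_expE (φ : (Dyad n → Bool × Bool) → Prop) :
    Pr n m v w g θ (fun x => φ (dyadConfig x))
      = expE (netStat n m v w g) θ (fun ω => if φ ω then 1 else 0) := by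
  rw [← Emean_eq, Pr, Emean, Finset.sum_filter]
  exact Finset.sum_congr rfl fun x _ => by split_ifs <;> simp

/-- Chebyshev bound for the coordinates of the score. -/
theorem Pr_score_gt_le (hR : ∀ q a i, |dyadStat n m v w g q a i| ≤ R) {M : ℝ} (hM : 0 < M)
    (hN : 0 < Ndyads n) (l : Idx m) :
    Pr n m v w g θ (fun x => M * √(Ndyads n)
        < |svec n m v w g x l - Emean n m v w g θ (fun x => svec n m v w g x l)|)
      ≤ 2 * R * R / M ^ 2 := by
  have hN' : (0 : ℝ) < Ndyads n := by exact_mod_cast hN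
  simp only [svec_eq_netStat]
  have h1 := Emean_svec n m v w g θ l
  simp only [svec_eq_netStat] at h1
  rw [h1]
  set f : (Dyad n → Bool × Bool) → ℝ := fun ω => netStat n m v w g ω l with hf
  set μ := expE (netStat n m v w g) θ f with hμ
  rw [Pr_eq_expE (fun ω => M * √(Ndyads n) < |f ω - μ|)]
  have h2 : expE (netStat n m v w g) θ (fun ω => if M * √(Ndyads n) < |f ω - μ| then 1 else 0)
      ≤ expE (netStat n m v w g) θ (fun ω => (M ^ 2 * Ndyads n)⁻¹ * (f ω - μ) ^ 2) := by
    refine expE_mono _ _ fun ω => ?_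
    split_ifs with h
    · rw [← div_eq_inv_mul, le_div_iff₀ (by positivity), one_mul]
      have : (M * √(Ndyads n)) ^ 2 ≤ |f ω - μ| ^ 2 :=
        pow_le_pow_left₀ (by positivity) h.le 2
      rwa [sq_abs, mul_pow, Real.sq_sqrt hN'.le] at this
    · positivity
  refine h2.trans ?_
  rw [expE_const_mul, hμ, expE_sq_sub_mean]
  have h3 := abs_Ifish_le (θ := θ) hR l l
  rw [Ifish_eq] at h3
  have h4 := (le_abs_self _).trans h3
  rw [← div_eq_inv_mul, div_le_div_iff₀ (by positivity) (by positivity)]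
  nlinarith [mul_le_mul_of_nonneg_right h4 (sq_nonneg M)]

theorem Pr_abs_score_le (hR : ∀ q a i, |dyadStat n m v w g q a i| ≤ R) (hR0 : 0 ≤ R)
    (b : Idx m → ℝ) {h τ : ℝ} {J : ℕ} (hJ : 0 < J) (hh : 0 ≤ h)
    (hJK : J * h * (2 * (Fintype.card (Idx m) * R * ‖b‖)) ≤ π) (hJτ : J * h * τ ≤ 1) :
    Pr n m v w g θ (fun x => |∑ l, b l
        * (svec n m v w g x l - Emean n m v w g θ (fun x => svec n m v w g x l))| ≤ τ)
      ≤ 4 / J + 4 * Real.exp (-(2 / π ^ 2) * h ^ 2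
          * (b ⬝ᵥ (Ifish n m v w g θ).mulVec b)) := by
  rw [dotProduct_Ifish_mulVec]
  have h1 := expE_indicator_sumStat_le (dyadStat n m v w g) θ
    (fun q a => b ⬝ᵥ dyadStat n m v w g q a)
    (∑ l, b l * Emean n m v w g θ (fun x => svec n m v w g x l)) hJ hh (by positivity)
    (fun q a => abs_dotProduct_le (hR q a)) hJK hJτ
  simp only [← dotProduct_sumStat] at h1
  refine le_trans (le_of_eq ?_) h1
  rw [← Pr_eq_expE]
  congr 1
  funext x
  simp only [mul_sub, Finset.sum_sub_distrib, ← svec_eq_netStat]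
  rfl

end Network

section Deterministic

variable {ι : Type*} [Fintype ι]

/-- Regularity of a realized log-likelihood `L` around `θ₀`, at sample size `N`: here `s` is the
observed statistic and `μ θ` its mean under `θ`. -/
structure LikelihoodRegular (Θ : Set (ι → ℝ)) (θ₀ : ι → ℝ) (L : (ι → ℝ) → ℝ) (s : ι → ℝ)
    (μ : (ι → ℝ) → ι → ℝ) (c A C ρ N : ℝ) : Prop where
  quadratic : ∀ θ ∈ Θ, L θ - L θ₀ ≤ A * √N * ‖θ - θ₀‖ - c * N * ‖θ - θ₀‖ ^ 2
  tangent : ∀ θ θ', L θ - L θ' ≤ ∑ i, (θ - θ') i * (s i - μ θ' i)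
  score : ∀ θ, ‖θ - θ₀‖ ≤ ρ → ∀ l, |s l - μ θ l| ≤ A * √N + C * N * ‖θ - θ₀‖
  ball : ∀ θ, ‖θ - θ₀‖ < ρ → θ ∈ Θ
  nonzero : ∀ θ ∈ Θ, (∀ θ' ∈ Θ, L θ' ≤ L θ) → ∀ k, θ₀ k = 0 → θ k ≠ 0

theorem mul_sq_le_of_quadratic {c A N x b : ℝ} (hc : 0 < c) (hN : 0 < N)
    (h : -b ≤ A * √N * x - c * N * x ^ 2) : N * x ^ 2 ≤ (A ^ 2 / c + 2 * b) / c := by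
  have hs : √N ^ 2 = N := Real.sq_sqrt hN.le
  have h1 : A * √N * x ≤ c * N * x ^ 2 / 2 + A ^ 2 / c / 2 := by
    have : 0 ≤ (c * (√N * x) - A) ^ 2 / (2 * c) := by positivity
    have h2 : (c * (√N * x) - A) ^ 2 / (2 * c)
        = c * (√N ^ 2 * x ^ 2) / 2 - A * √N * x + A ^ 2 / c / 2 := by
      field_simp; ring
    rw [h2, hs] at this
    nlinarith
  rw [le_div_iff₀ hc]
  nlinarith

theorem sqrt_mul_norm_le_of_le {L : (ι → ℝ) → ℝ} {c A N : ℝ} {θ θ₀ : ι → ℝ} (hc : 0 < c)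
    (hA : 0 ≤ A) (hN : 0 < N)
    (hquad : L θ - L θ₀ ≤ A * √N * ‖θ - θ₀‖ - c * N * ‖θ - θ₀‖ ^ 2) (hle : L θ₀ ≤ L θ) :
    √N * ‖θ - θ₀‖ ≤ A / c := by
  have hsN : 0 < √N := Real.sqrt_pos.2 hN
  rcases (norm_nonneg (θ - θ₀)).eq_or_lt with h0 | h0
  · rw [← h0, mul_zero]; positivity
  rw [le_div_iff₀ hc]
  have h1 : √N * ‖θ - θ₀‖ * c * (√N * ‖θ - θ₀‖) ≤ A * (√N * ‖θ - θ₀‖) := by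
    have h2 : √N * √N = N := Real.mul_self_sqrt hN.le
    have h3 : √N * ‖θ - θ₀‖ * c * (√N * ‖θ - θ₀‖) = c * N * ‖θ - θ₀‖ ^ 2 := by
      linear_combination (c * ‖θ - θ₀‖ ^ 2) * h2
    rw [h3]; linarith
  exact le_of_mul_le_mul_right h1 (mul_pos hsN h0)

variable {Θ : Set (ι → ℝ)} {θ₀ : ι → ℝ} {L : (ι → ℝ) → ℝ} {s : ι → ℝ}
  {μ : (ι → ℝ) → ι → ℝ} {c A C ρ N c₁ c₂ r lam₀ ν : ℝ} {θM : ι → ℝ}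

/-- Likelihood loss of a penalized estimator with adaptive weights. -/
theorem likelihood_sub_le_of_penalized {lam : ℝ} {θ : ι → ℝ} (hlam : 0 ≤ lam) (hM : θM ∈ Θ)
    (hpen : ∀ θ' ∈ Θ, -L θ + lam * ∑ k, |θM k|⁻¹ * |θ k|
      ≤ -L θ' + lam * ∑ k, |θM k|⁻¹ * |θ' k|) :
    L θM - L θ ≤ Fintype.card ι * lam := by
  have h1 := hpen θM hM
  have h2 : ∑ k, |θM k|⁻¹ * |θM k| ≤ Fintype.card ι := by
    calc ∑ k, |θM k|⁻¹ * |θM k| ≤ ∑ k : ι, (1 : ℝ) :=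
          Finset.sum_le_sum fun k _ => inv_mul_le_one
      _ = _ := by simp
  have h3 : 0 ≤ ∑ k, |θM k|⁻¹ * |θ k| := Finset.sum_nonneg fun k _ => by positivity
  nlinarith [mul_nonneg hlam h3, mul_le_mul_of_nonneg_left h2 hlam]

theorem ne_zero_of_norm_sub_lt {θ : ι → ℝ} (hν : ∀ k, θ₀ k ≠ 0 → ν ≤ |θ₀ k|)
    (h : ‖θ - θ₀‖ < ν) {k : ι} (hk : θ₀ k ≠ 0) : θ k ≠ 0 := fun h0 => by
  have h1 := norm_le_pi_norm (θ - θ₀) k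
  rw [Pi.sub_apply, h0, zero_sub, norm_neg, Real.norm_eq_abs] at h1
  linarith [hν k hk]

/-- At a tuning parameter of logarithmic order, the penalized estimator is within
`√(log N / N)` of `θ₀`, up to a constant. -/
theorem norm_sq_le_of_penalized {θ : ι → ℝ} {lam D : ℝ} (hc : 0 < c) (hN : 0 < N)
    (hr : 1 ≤ r) (hlam0 : 0 ≤ lam) (hlam : lam ≤ c₂ * r)
    (hD : D = (A ^ 2 / c + 2 * (Fintype.card ι * c₂)) / c)
    (hquad : L θ - L θ₀ ≤ A * √N * ‖θ - θ₀‖ - c * N * ‖θ - θ₀‖ ^ 2)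
    (hθM : θM ∈ Θ) (hle : L θ₀ ≤ L θM)
    (hpen : ∀ θ' ∈ Θ, -L θ + lam * ∑ k, |θM k|⁻¹ * |θ k|
      ≤ -L θ' + lam * ∑ k, |θM k|⁻¹ * |θ' k|) :
    ‖θ - θ₀‖ ^ 2 ≤ D * r / N := by
  have hloss := likelihood_sub_le_of_penalized hlam0 hθM hpen
  have h2 : (Fintype.card ι : ℝ) * lam ≤ Fintype.card ι * (c₂ * r) :=
    mul_le_mul_of_nonneg_left hlam (Nat.cast_nonneg _)
  have hb : -(Fintype.card ι * c₂ * r) ≤ L θ - L θ₀ := by linarith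
  have hx := mul_sq_le_of_quadratic hc hN (hb.trans hquad)
  rw [le_div_iff₀ hN, mul_comm]
  refine hx.trans ?_
  rw [hD, div_mul_eq_mul_div]
  refine div_le_div_of_nonneg_right ?_ hc.le
  have : A ^ 2 / c ≤ A ^ 2 / c * r := le_mul_of_one_le_right (by positivity) hr
  linarith

/-- At a reference tuning parameter of logarithmic order, the adaptive penalized estimator
recovers the support of `θ₀`. -/
theorem support_eq_of_regular (hreg : LikelihoodRegular Θ θ₀ L s μ c A C ρ N)
    (hc : 0 < c) (hA : 0 < A) (hC : 0 ≤ C) (hρ : 0 < ρ) (hN : 0 < N) (hc₁ : 0 < c₁)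
    (hν0 : 0 < ν) (hν : ∀ k, θ₀ k ≠ 0 → ν ≤ |θ₀ k|) (hr : 1 ≤ r)
    (hlam : c₁ * r ≤ lam₀ ∧ lam₀ ≤ c₂ * r)
    {D : ℝ} (hD : D = (A ^ 2 / c + 2 * (Fintype.card ι * c₂)) / c)
    (hDρ : D * r / N < ρ ^ 2) (hDν : D * r / N < ν ^ 2)
    (hbig : A + C * √(D * r) < c₁ * c * r / A)
    (hθM : θM ∈ Θ ∧ ∀ θ ∈ Θ, L θ ≤ L θM) {θ : ι → ℝ} (hθ : θ ∈ Θ)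
    (hpen : ∀ θ' ∈ Θ, -L θ + lam₀ * ∑ k, |θM k|⁻¹ * |θ k|
      ≤ -L θ' + lam₀ * ∑ k, |θM k|⁻¹ * |θ' k|) (k : ι) :
    θ k ≠ 0 ↔ θ₀ k ≠ 0 := by
  have hlam0 : 0 < lam₀ := lt_of_lt_of_le (by positivity) hlam.1
  have hθ₀ : θ₀ ∈ Θ := hreg.ball θ₀ (by simpa using hρ)
  have hx' := norm_sq_le_of_penalized hc hN hr hlam0.le hlam.2 hD (hreg.quadratic θ hθ) hθM.1
    (hθM.2 θ₀ hθ₀) hpen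
  have hxρ : ‖θ - θ₀‖ < ρ := lt_of_pow_lt_pow_left₀ 2 hρ.le (hx'.trans_lt hDρ)
  have hxν : ‖θ - θ₀‖ < ν := lt_of_pow_lt_pow_left₀ 2 hν0.le (hx'.trans_lt hDν)
  refine ⟨fun hk hk0 => ?_, fun hk => ne_zero_of_norm_sub_lt hν hxν hk⟩
  set θ' : ι → ℝ := Function.update θ k 0 with hθ'
  have hle : ‖θ' - θ₀‖ ≤ ‖θ - θ₀‖ := by
    rw [pi_norm_le_iff_of_nonneg (norm_nonneg _)]
    intro i
    by_cases hi : i = k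
    · subst hi; simp [hθ', hk0]
    · rw [Pi.sub_apply, hθ', Function.update_of_ne hi, ← Pi.sub_apply]
      exact norm_le_pi_norm _ i
  have hθ'Θ := hreg.ball θ' (hle.trans_lt hxρ)
  have hsum : ∀ F : ι → ℝ → ℝ, (∑ i, F i (θ i)) - ∑ i, F i (θ' i) = F k (θ k) - F k 0 := by
    intro F
    rw [← Finset.sum_sub_distrib, Finset.sum_eq_single k]
    · simp [hθ']
    · intro i _ hi
      rw [hθ', Function.update_of_ne hi, sub_self]
    · simp
  have h1 := hpen θ' hθ'Θ
  have h2 := hsum (fun i t => |θM i|⁻¹ * |t|)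
  simp only [abs_zero, mul_zero, sub_zero] at h2
  have h3 : lam₀ * (|θM k|⁻¹ * |θ k|) ≤ L θ - L θ' := by
    rw [← h2, mul_sub]; linarith
  have h4 := hreg.tangent θ θ'
  have h5 : ∑ i, (θ - θ') i * (s i - μ θ' i) = θ k * (s k - μ θ' k) := by
    rw [Finset.sum_eq_single k]
    · simp [hθ']
    · intro i _ hi
      rw [Pi.sub_apply, hθ', Function.update_of_ne hi, sub_self, zero_mul]
    · simp
  have hxs : ‖θ' - θ₀‖ ≤ √(D * r / N) := hle.trans (Real.le_sqrt_of_sq_le hx')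
  have hsN : 0 < √N := Real.sqrt_pos.2 hN
  have hNsq : √N * √N = N := Real.mul_self_sqrt hN.le
  have h6 : |s k - μ θ' k| ≤ √N * (A + C * √(D * r)) := by
    refine (hreg.score θ' (hle.trans hxρ.le) k).trans ?_
    have h7 : N * ‖θ' - θ₀‖ ≤ √N * √(D * r) := by
      have : √(D * r / N) = √(D * r) / √N := Real.sqrt_div' _ hN.le
      rw [this] at hxs
      calc N * ‖θ' - θ₀‖ ≤ N * (√(D * r) / √N) := mul_le_mul_of_nonneg_left hxs hN.le
        _ = √N * √(D * r) := by
            rw [mul_div_assoc', div_eq_iff hsN.ne']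
            linear_combination (-√(D * r)) * hNsq
    nlinarith [mul_le_mul_of_nonneg_left h7 hC]
  have hθk : 0 < |θ k| := abs_pos.2 hk
  have h8 : lam₀ * |θM k|⁻¹ ≤ √N * (A + C * √(D * r)) := by
    have h9 : θ k * (s k - μ θ' k) ≤ |θ k| * (√N * (A + C * √(D * r))) :=
      (le_abs_self _).trans (by
        rw [abs_mul]; exact mul_le_mul_of_nonneg_left h6 (abs_nonneg _))
    have h10 : lam₀ * |θM k|⁻¹ * |θ k| ≤ √N * (A + C * √(D * r)) * |θ k| := by
      rw [h5] at h4; nlinarith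
    exact le_of_mul_le_mul_right h10 hθk
  have hMk : θM k ≠ 0 := hreg.nonzero θM hθM.1 hθM.2 k hk0
  have hMpos : 0 < |θM k| := abs_pos.2 hMk
  have h11 : √N * |θM k| ≤ A / c := by
    have h13 : |θM k| ≤ ‖θM - θ₀‖ := by
      have := norm_le_pi_norm (θM - θ₀) k
      rwa [Pi.sub_apply, hk0, sub_zero, Real.norm_eq_abs] at this
    have h15 := sqrt_mul_norm_le_of_le hc hA.le hN (hreg.quadratic θM hθM.1) (hθM.2 θ₀ hθ₀)
    exact (mul_le_mul_of_nonneg_left h13 hsN.le).trans h15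
  have h16 : c₁ * r ≤ A / c * (A + C * √(D * r)) := by
    have hpos : 0 ≤ A + C * √(D * r) := by positivity
    rw [← div_eq_mul_inv, div_le_iff₀ hMpos] at h8
    calc c₁ * r ≤ lam₀ := hlam.1
      _ ≤ √N * |θM k| * (A + C * √(D * r)) := by linarith
      _ ≤ _ := mul_le_mul_of_nonneg_right h11 hpos
  rw [lt_div_iff₀ hA] at hbig
  have h17 : A / c * (A + C * √(D * r)) * c = A * (A + C * √(D * r)) := by field_simp
  nlinarith [mul_le_mul_of_nonneg_right h16 hc.le]

/-- The information criterion with sample size `N`, log-likelihood `L` and log-size `r`. -/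
def infoCrit (N r : ℝ) (L : (ι → ℝ) → ℝ) (θ : ι → ℝ) : ℝ :=
  -(√N)⁻¹ * L θ + r * ((Finset.univ.filter fun k => θ k ≠ 0).card : ℝ)

theorem infoCrit_add_one_le_of_regular (hreg : LikelihoodRegular Θ θ₀ L s μ c A C ρ N)
    (hc : 0 < c) (hρ : 0 < ρ) (hN : 0 < N) (hν0 : 0 < ν)
    (hν : ∀ k, θ₀ k ≠ 0 → ν ≤ |θ₀ k|) (hr : 2 ≤ r) (hlam0 : 0 ≤ lam₀) (hlam : lam₀ ≤ c₂ * r)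
    (hover : 2 * (Fintype.card ι * c₂) ≤ √N)
    (hunder : √N * (1 + r * Fintype.card ι) + A ^ 2 / c / 2 + Fintype.card ι * c₂ * r
      ≤ c * ν ^ 2 / 2 * N)
    (hθM : θM ∈ Θ ∧ ∀ θ ∈ Θ, L θ ≤ L θM) {θ : ι → ℝ}
    (hpen : ∀ θ' ∈ Θ, -L θ + lam₀ * ∑ k, |θM k|⁻¹ * |θ k|
      ≤ -L θ' + lam₀ * ∑ k, |θM k|⁻¹ * |θ' k|)
    (hsupp : ∀ k, θ k ≠ 0 ↔ θ₀ k ≠ 0) {θ' : ι → ℝ} (hθ' : θ' ∈ Θ)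
    (hsel : (¬ ∀ k, θ₀ k ≠ 0 → θ' k ≠ 0) ∨
      ((∀ k, θ₀ k ≠ 0 → θ' k ≠ 0) ∧ ∃ k, θ₀ k = 0 ∧ θ' k ≠ 0)) :
    infoCrit N r L θ + 1 ≤ infoCrit N r L θ' := by
  have hθ₀ : θ₀ ∈ Θ := hreg.ball θ₀ (by simpa using hρ)
  have hloss := likelihood_sub_le_of_penalized hlam0 hθM.1 hpen
  have hloss' : L θM - L θ ≤ Fintype.card ι * c₂ * r := by
    have h2 : (Fintype.card ι : ℝ) * lam₀ ≤ Fintype.card ι * (c₂ * r) :=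
      mul_le_mul_of_nonneg_left hlam (Nat.cast_nonneg _)
    nlinarith
  have hsN : 0 < √N := Real.sqrt_pos.2 hN
  have hNsq : √N * √N = N := Real.mul_self_sqrt hN.le
  have hcardθ : (Finset.univ.filter fun k => θ k ≠ 0) = Finset.univ.filter fun k => θ₀ k ≠ 0 := by
    ext k; simp [hsupp k]
  have key : ∀ B : ℝ, √N * B ≤ L θ - L θ' → B ≤ -(√N)⁻¹ * L θ' - -(√N)⁻¹ * L θ := by
    intro B hB
    have : -(√N)⁻¹ * L θ' - -(√N)⁻¹ * L θ = (L θ - L θ') / √N := by field_simp; ring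
    rw [this, le_div_iff₀ hsN]
    linarith
  rw [infoCrit, infoCrit, hcardθ]
  rcases hsel with hsel | ⟨hsub, k, hk0, hk⟩
  · push Not at hsel
    obtain ⟨k, hk, hk'⟩ := hsel
    have hfar : ν ≤ ‖θ' - θ₀‖ := by
      by_contra hlt
      exact ne_zero_of_norm_sub_lt hν (not_le.1 hlt) hk hk'
    have h1 := hreg.quadratic θ' hθ'
    have h2 : A * √N * ‖θ' - θ₀‖ ≤ c * N * ‖θ' - θ₀‖ ^ 2 / 2 + A ^ 2 / c / 2 := by
      have : 0 ≤ (c * (√N * ‖θ' - θ₀‖) - A) ^ 2 / (2 * c) := by positivity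
      have h2 : (c * (√N * ‖θ' - θ₀‖) - A) ^ 2 / (2 * c)
          = c * ((√N * √N) * ‖θ' - θ₀‖ ^ 2) / 2 - A * √N * ‖θ' - θ₀‖ + A ^ 2 / c / 2 := by
        field_simp; ring
      rw [h2, hNsq] at this
      nlinarith
    have h3 : ν ^ 2 ≤ ‖θ' - θ₀‖ ^ 2 := pow_le_pow_left₀ hν0.le hfar 2
    have h4 : c * N * ν ^ 2 ≤ c * N * ‖θ' - θ₀‖ ^ 2 :=
      mul_le_mul_of_nonneg_left h3 (by positivity)
    have h5 := hθM.2 θ₀ hθ₀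
    have h6 := key (1 + r * Fintype.card ι) (by nlinarith)
    have h7 : ((Finset.univ.filter fun k => θ₀ k ≠ 0).card : ℝ) ≤ Fintype.card ι := by
      exact_mod_cast Finset.card_le_univ _
    have h8 : r * ((Finset.univ.filter fun k => θ₀ k ≠ 0).card : ℝ) ≤ r * Fintype.card ι :=
      mul_le_mul_of_nonneg_left h7 (by linarith)
    have h9 : 0 ≤ r * ((Finset.univ.filter fun k => θ' k ≠ 0).card : ℝ) := by positivity
    linarith
  · have hcard : (Finset.univ.filter fun k => θ₀ k ≠ 0).card + 1
        ≤ (Finset.univ.filter fun k => θ' k ≠ 0).card := by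
      refine Finset.card_lt_card ⟨?_, fun hcon => ?_⟩
      · intro i hi
        simp only [Finset.mem_filter, Finset.mem_univ, true_and] at hi ⊢
        exact hsub i hi
      · have := hcon (show k ∈ Finset.univ.filter fun k => θ' k ≠ 0 by simp [hk])
        simp [hk0] at this
    have hcard' : ((Finset.univ.filter fun k => θ₀ k ≠ 0).card : ℝ) + 1
        ≤ ((Finset.univ.filter fun k => θ' k ≠ 0).card : ℝ) := by exact_mod_cast hcard
    have h1 : r * (((Finset.univ.filter fun k => θ₀ k ≠ 0).card : ℝ) + 1)
        ≤ r * ((Finset.univ.filter fun k => θ' k ≠ 0).card : ℝ) :=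
      mul_le_mul_of_nonneg_left hcard' (by linarith)
    have h2 := hθM.2 θ' hθ'
    have h3 := key (-(r / 2)) (by nlinarith)
    linarith

theorem abs_sum_mul_score_le [DecidableEq ι] {I₁ I₀ : ι → ι → ℝ} {b u S : ι → ℝ} {C ε N : ℝ} {k : ι}
    (hexp : ∀ l, |S l - ∑ j, I₁ l j * u j| ≤ C) (hI : ∀ l j, |I₁ l j - N * I₀ l j| ≤ ε)
    (hb : ∀ j, ∑ l, b l * I₀ l j = if k = j then 1 else 0) (hk : u k = 0) :
    |∑ l, b l * S l| ≤ (∑ l, |b l|) * (C + Fintype.card ι * ε * ‖u‖) := by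
  have h0 : ∑ l, b l * (∑ j, N * I₀ l j * u j) = 0 := by
    have : ∑ l, b l * (∑ j, N * I₀ l j * u j) = N * ∑ j, (∑ l, b l * I₀ l j) * u j := by
      simp only [Finset.mul_sum, Finset.sum_mul]
      rw [Finset.sum_comm]
      exact Finset.sum_congr rfl fun _ _ => Finset.sum_congr rfl fun _ _ => by ring
    rw [this]
    simp [hb, hk]
  have h1 : ∑ l, b l * S l
      = ∑ l, b l * ((S l - ∑ j, I₁ l j * u j) + ∑ j, (I₁ l j - N * I₀ l j) * u j) := by
    have : ∀ l, b l * ((S l - ∑ j, I₁ l j * u j) + ∑ j, (I₁ l j - N * I₀ l j) * u j)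
        = b l * S l - b l * (∑ j, N * I₀ l j * u j) := fun l => by
      simp only [sub_mul, Finset.sum_sub_distrib]; ring
    simp only [this, Finset.sum_sub_distrib, h0, sub_zero]
  rw [h1, Finset.sum_mul]
  refine (Finset.abs_sum_le_sum_abs _ _).trans (Finset.sum_le_sum fun l _ => ?_)
  rw [abs_mul]
  refine mul_le_mul_of_nonneg_left ?_ (abs_nonneg _)
  refine (abs_add_le _ _).trans (add_le_add (hexp l) ?_)
  refine (Finset.abs_sum_le_sum_abs _ _).trans ?_
  calc ∑ j, |(I₁ l j - N * I₀ l j) * u j| ≤ ∑ j : ι, ε * ‖u‖ := by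
        refine Finset.sum_le_sum fun j _ => ?_
        rw [abs_mul]
        exact mul_le_mul (hI l j) (norm_le_pi_norm u j) (abs_nonneg _)
          ((abs_nonneg _).trans (hI l j))
    _ = _ := by simp only [Finset.sum_const, Finset.card_univ, nsmul_eq_mul]; ring

end Deterministic

section Asymptotics

open Filter Topology

theorem tendsto_Ndyads : Tendsto (fun n => (Ndyads n : ℝ)) atTop atTop := by
  refine tendsto_natCast_atTop_atTop.comp
    (tendsto_atTop_mono' atTop ?_ (tendsto_sub_atTop_nat 1))
  filter_upwards [eventually_ge_atTop 2] with n hn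
  rw [Ndyads, Nat.le_div_iff_mul_le two_pos, mul_comm]
  exact Nat.mul_le_mul_right _ hn

theorem tendsto_sqrt_Ndyads : Tendsto (fun n => √(Ndyads n : ℝ)) atTop atTop :=
  Real.tendsto_sqrt_atTop.comp tendsto_Ndyads

theorem tendsto_log_Ndyads : Tendsto (fun n => Real.log (Ndyads n : ℝ)) atTop atTop :=
  Real.tendsto_log_atTop.comp tendsto_Ndyads

theorem tendsto_log_div_sqrt_Ndyads :
    Tendsto (fun n => Real.log (Ndyads n : ℝ) / √(Ndyads n : ℝ)) atTop (𝓝 0) := by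
  have h := (isLittleO_log_rpow_atTop (r := 1 / 2) (by norm_num)).tendsto_div_nhds_zero
  simp only [← Real.sqrt_eq_rpow] at h
  exact h.comp tendsto_Ndyads

theorem exists_mul_sq_le_of_posDef {ι : Type*} [Fintype ι] [Nonempty ι] {I : Matrix ι ι ℝ}
    (hI : I.PosDef) : ∃ c > 0, ∀ u : ι → ℝ, c * ‖u‖ ^ 2 ≤ u ⬝ᵥ I.mulVec u := by
  have hcont : Continuous fun u : ι → ℝ => u ⬝ᵥ I.mulVec u :=
    continuous_id.dotProduct (Continuous.matrix_mulVec continuous_const continuous_id)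
  obtain ⟨u₀, hu₀, hmin⟩ := (isCompact_sphere (0 : ι → ℝ) 1).exists_isMinOn
    (NormedSpace.sphere_nonempty.2 zero_le_one) hcont.continuousOn
  have hu₀' : ‖u₀‖ = 1 := by simpa using hu₀
  have hu₀0 : u₀ ≠ 0 := fun h => by simp [h] at hu₀'
  refine ⟨u₀ ⬝ᵥ I.mulVec u₀, by simpa using hI.dotProduct_mulVec_pos hu₀0, fun u => ?_⟩
  rcases eq_or_ne u 0 with rfl | hu
  · simp
  have hpos : 0 < ‖u‖ := norm_pos_iff.2 hu
  have h1 : u₀ ⬝ᵥ I.mulVec u₀ ≤ (‖u‖⁻¹ • u) ⬝ᵥ I.mulVec (‖u‖⁻¹ • u) :=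
    hmin (by simp [norm_smul, hpos.ne'])
  rw [Matrix.mulVec_smul, smul_dotProduct, dotProduct_smul, smul_eq_mul, smul_eq_mul,
    ← mul_assoc, ← mul_inv, ← sq, inv_mul_eq_div, le_div_iff₀ (by positivity)] at h1
  exact h1

variable {m : ℕ} {v : (n : ℕ) → Fin n → Fin m → E} {w : E → E → ℝ} {g : E → ℝ}
  {θ₀ : Idx m → ℝ} {Θ : Set (Idx m → ℝ)} {I : Matrix (Idx m) (Idx m) ℝ} {R : ℝ}

theorem exists_dyadStat_bound (hC1 : CondC1 m v w g θ₀ Θ) :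
    ∃ R, 1 ≤ R ∧ ∀ n q a i, |dyadStat n m (v n) w g q a i| ≤ R := by
  obtain ⟨⟨B, hB⟩, -⟩ := hC1
  have hb : ∀ (b : Bool) (y : ℝ), |y| ≤ B → |bval b * y| ≤ |B| + 1 := fun b y hy => by
    have := le_abs_self B
    cases b
    · simp only [bval, Bool.false_eq_true, if_false, zero_mul, abs_zero]; positivity
    · simp only [bval, if_true, one_mul]; linarith
  have hadd : ∀ a b : ℝ, |a| ≤ |B| + 1 → |b| ≤ |B| + 1 → |a + b| ≤ 2 * (|B| + 1) :=
    fun a b ha hb => (abs_add_le a b).trans (by linarith)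
  have hB0 := abs_nonneg B
  refine ⟨2 * (|B| + 1), by linarith, ?_⟩
  rintro n q ⟨a, b⟩ (i | k | k | k)
  · simp only [dyadStat]
    split_ifs <;> cases a <;> cases b <;> simp [bval, abs_of_nonneg] <;> linarith
  · exact hadd _ _ (hb _ _ (hB n _ _ k).1) (hb _ _ (hB n _ _ k).1)
  · exact hadd _ _ (hb _ _ (hB n _ q.1.2 k).2) (hb _ _ (hB n _ q.1.2 k).2)
  · exact hadd _ _ (hb _ _ (hB n _ q.1.2 k).2) (hb _ _ (hB n _ q.1.2 k).2)

theorem eventually_abs_Ifish_sub_le (hC2 : CondC2 m v w g θ₀ I) {ε : ℝ} (hε : 0 < ε) :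
    ∀ᶠ n in atTop, ∀ k l,
      |Ifish n m (v n) w g θ₀ k l - Ndyads n * I k l| ≤ ε * Ndyads n := by
  rw [eventually_all]
  intro k
  rw [eventually_all]
  intro l
  have h := ((continuous_apply_apply k l).tendsto I).comp hC2.1
  filter_upwards [Metric.tendsto_nhds.1 h ε hε, tendsto_Ndyads.eventually_gt_atTop 0]
    with n hn hN
  rw [Real.dist_eq] at hn
  have h1 : Ifish n m (v n) w g θ₀ k l - Ndyads n * I k l
      = ((Ndyads n : ℝ)⁻¹ * Ifish n m (v n) w g θ₀ k l - I k l) * Ndyads n := by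
    field_simp
  rw [h1, abs_mul, abs_of_pos hN]
  exact mul_le_mul_of_nonneg_right hn.le hN.le

theorem exists_eventually_mul_sq_le_Ifish (hC2 : CondC2 m v w g θ₀ I) :
    ∃ c > 0, ∀ᶠ n in atTop, ∀ u : Idx m → ℝ,
      c * Ndyads n * ‖u‖ ^ 2 ≤ u ⬝ᵥ (Ifish n m (v n) w g θ₀).mulVec u := by
  obtain ⟨c, hc, hI⟩ := exists_mul_sq_le_of_posDef hC2.2
  set d : ℝ := ((Fintype.card (Idx m) : ℕ) : ℝ) with hd
  have hd0 : 0 < d := by rw [hd]; exact_mod_cast Fintype.card_pos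
  refine ⟨c / 2, by positivity, ?_⟩
  filter_upwards [eventually_abs_Ifish_sub_le hC2 (ε := c / (2 * d ^ 2)) (by positivity)]
    with n hn u
  have hN : (0 : ℝ) ≤ Ndyads n := Nat.cast_nonneg _
  set Δ : Matrix (Idx m) (Idx m) ℝ := Ifish n m (v n) w g θ₀ - (Ndyads n : ℝ) • I with hΔ
  have h1 : ∀ k, |Δ.mulVec u k| ≤ d * (c / (2 * d ^ 2) * Ndyads n) * ‖u‖ := fun k => by
    have := abs_dotProduct_le (u := u) (y := Δ k) (R := c / (2 * d ^ 2) * Ndyads n)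
      (fun l => hn k l)
    rwa [dotProduct_comm] at this
  have h2 := abs_dotProduct_le (u := u) h1
  have h3 : u ⬝ᵥ (Ifish n m (v n) w g θ₀).mulVec u
      = Ndyads n * (u ⬝ᵥ I.mulVec u) + u ⬝ᵥ Δ.mulVec u := by
    rw [hΔ, Matrix.sub_mulVec, dotProduct_sub, Matrix.smul_mulVec, dotProduct_smul, smul_eq_mul]
    ring
  have h4 : d * (d * (c / (2 * d ^ 2) * Ndyads n) * ‖u‖) * ‖u‖
      = c / 2 * Ndyads n * ‖u‖ ^ 2 := by field_simp
  rw [← hd, h4] at h2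
  have h5 := mul_le_mul_of_nonneg_left (hI u) hN
  have h6 := (abs_le.1 h2).1
  rw [h3]
  linarith

/-- The score `s(x) - E_{θ₀} s(X)` of the network model. -/
def scoreVec (v : (n : ℕ) → Fin n → Fin m → E) (w : E → E → ℝ) (g : E → ℝ) (θ₀ : Idx m → ℝ)
    (n : ℕ) (x : Fin n → Fin n → Bool) (l : Idx m) : ℝ :=
  svec n m (v n) w g x l - Emean n m (v n) w g θ₀ (fun x => svec n m (v n) w g x l)

/-- Linear combinations of the score are not concentrated near zero at scale `√N`. -/
theorem exists_eventually_Pr_abs_score_le (hR0 : 1 ≤ R)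
    (hR : ∀ n q a i, |dyadStat n m (v n) w g q a i| ≤ R) (hC2 : CondC2 m v w g θ₀ I)
    {b : Idx m → ℝ} (hb : b ≠ 0) {ε : ℝ} (hε : 0 < ε) :
    ∃ κ > 0, ∀ᶠ n in atTop, Pr n m (v n) w g θ₀
      (fun x => |∑ l, b l * scoreVec v w g θ₀ n x l| ≤ κ * √(Ndyads n)) ≤ ε := by
  obtain ⟨c, hc, hI⟩ := exists_eventually_mul_sq_le_Ifish hC2
  obtain ⟨J, hJ⟩ := exists_nat_gt (8 / ε)
  have hJ0 : (0 : ℝ) < J := lt_trans (by positivity) hJ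
  have hb0 : 0 < ‖b‖ := norm_pos_iff.2 hb
  set Y : ℝ := 2 / π ^ 2 * c * ‖b‖ ^ 2 with hY
  have hY0 : 0 < Y := by positivity
  set η : ℝ := √(8 / (ε * Y)) with hη
  have hη0 : 0 < η := Real.sqrt_pos.2 (by positivity)
  have hηsq : Y * η ^ 2 = 8 / ε := by
    rw [hη, Real.sq_sqrt (by positivity)]; field_simp
  refine ⟨1 / (J * η), by positivity, ?_⟩
  filter_upwards [hI, tendsto_sqrt_Ndyads.eventually_gt_atTop 0,
    tendsto_sqrt_Ndyads.eventually_ge_atTop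
      (J * η * (2 * (Fintype.card (Idx m) * R * ‖b‖)) / π)] with n hn hN hN'
  have hNsq : √(Ndyads n : ℝ) ^ 2 = Ndyads n := Real.sq_sqrt (Nat.cast_nonneg _)
  refine (Pr_abs_score_le (hR n) (by linarith) b (h := η / √(Ndyads n)) (J := J)
    (by exact_mod_cast hJ0) (by positivity) ?_ ?_).trans ?_
  · rw [div_le_iff₀ Real.pi_pos] at hN'
    have : J * (η / √(Ndyads n)) * (2 * (Fintype.card (Idx m) * R * ‖b‖))
        = J * η * (2 * (Fintype.card (Idx m) * R * ‖b‖)) / √(Ndyads n) := by ring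
    rw [this, div_le_iff₀ hN, mul_comm π]
    exact hN'
  · exact le_of_eq (by field_simp)
  · have h1 : 4 / (J : ℝ) ≤ ε / 2 := by
      rw [div_lt_iff₀ hε] at hJ
      rw [div_le_iff₀ hJ0]; linarith
    have h2 : Y * η ^ 2 ≤ 2 / π ^ 2 * (η / √(Ndyads n)) ^ 2
        * (b ⬝ᵥ (Ifish n m (v n) w g θ₀).mulVec b) := by
      have h3 := mul_le_mul_of_nonneg_left (hn b)
        (show 0 ≤ 2 / π ^ 2 * (η / √(Ndyads n)) ^ 2 by positivity)
      refine le_trans (le_of_eq ?_) h3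
      rw [hY]
      field_simp
      rw [hNsq]
    have h4 : Real.exp (-(2 / π ^ 2) * (η / √(Ndyads n)) ^ 2
        * (b ⬝ᵥ (Ifish n m (v n) w g θ₀).mulVec b)) ≤ ε / 8 := by
      refine (Real.exp_le_exp.2 (show _ ≤ -(8 / ε) by linarith)).trans ?_
      rw [Real.exp_neg, inv_le_comm₀ (Real.exp_pos _) (by positivity), inv_div]
      linarith [Real.add_one_le_exp (8 / ε)]
    linarith

/-- The score is of order `√N` and its projections along the rows of `b` are not smaller. -/
def TypicalScore (v : (n : ℕ) → Fin n → Fin m → E) (w : E → E → ℝ) (g : E → ℝ)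
    (θ₀ : Idx m → ℝ) (b : Idx m → Idx m → ℝ) (M κ : ℝ) (n : ℕ)
    (x : Fin n → Fin n → Bool) : Prop :=
  (∀ l, |scoreVec v w g θ₀ n x l| ≤ M * √(Ndyads n)) ∧
    ∀ k, κ * √(Ndyads n) < |∑ l, b k l * scoreVec v w g θ₀ n x l|

theorem exists_eventually_typicalScore (hR0 : 1 ≤ R)
    (hR : ∀ n q a i, |dyadStat n m (v n) w g q a i| ≤ R) (hC2 : CondC2 m v w g θ₀ I)
    {b : Idx m → Idx m → ℝ} (hb : ∀ k, b k ≠ 0) {ε : ℝ} (hε : 0 < ε) :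
    ∃ M κ, 0 < M ∧ 0 < κ ∧ ∀ᶠ n in atTop,
      1 - ε ≤ Pr n m (v n) w g θ₀ (TypicalScore v w g θ₀ b M κ n) := by
  set d : ℝ := ((Fintype.card (Idx m) : ℕ) : ℝ) with hd
  have hd0 : 0 < d := by rw [hd]; exact_mod_cast Fintype.card_pos
  have hε' : 0 < ε / (2 * d) := by positivity
  choose κ hκ hPr using fun k =>
    exists_eventually_Pr_abs_score_le hR0 hR hC2 (hb k) hε'
  set M : ℝ := √(2 * R * R / (ε / (2 * d))) with hM
  have hM0 : 0 < M := Real.sqrt_pos.2 (by positivity)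
  have hMsq : 2 * R * R / M ^ 2 = ε / (2 * d) := by
    rw [hM, Real.sq_sqrt (by positivity)]
    have : R ≠ 0 := by positivity
    field_simp
  have hne : (Finset.univ : Finset (Idx m)).Nonempty := Finset.univ_nonempty
  refine ⟨M, Finset.univ.inf' hne κ, hM0, (Finset.lt_inf'_iff hne).2 fun k _ => hκ k, ?_⟩
  filter_upwards [eventually_all.2 hPr, tendsto_Ndyads.eventually_gt_atTop 0] with n hn hN
  set bad : Idx m ⊕ Idx m → (Fin n → Fin n → Bool) → Prop := Sum.elim
    (fun l x => M * √(Ndyads n) < |scoreVec v w g θ₀ n x l|)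
    (fun k x => |∑ l, b k l * scoreVec v w g θ₀ n x l| ≤ κ k * √(Ndyads n)) with hbad
  have h1 : Pr n m (v n) w g θ₀ (fun x => ∃ k ∈ (Finset.univ : Finset (Idx m ⊕ Idx m)), bad k x)
      ≤ ε := by
    refine (Pr_exists_le _ _).trans ?_
    rw [Fintype.sum_sum_type]
    have h2 : ∑ l, Pr n m (v n) w g θ₀ (bad (Sum.inl l)) ≤ ∑ _l : Idx m, ε / (2 * d) :=
      Finset.sum_le_sum fun l _ =>
        (Pr_score_gt_le (hR n) hM0 (by exact_mod_cast hN) l).trans hMsq.le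
    have h3 : ∑ k, Pr n m (v n) w g θ₀ (bad (Sum.inr k)) ≤ ∑ _k : Idx m, ε / (2 * d) :=
      Finset.sum_le_sum fun k _ => hn k
    have h4 : ∑ _k : Idx m, ε / (2 * d) = ε / 2 := by
      rw [Finset.sum_const, Finset.card_univ, nsmul_eq_mul, ← hd]; field_simp
    linarith
  have h5 := Pr_add_Pr_not (n := n) (v := v n) (w := w) (g := g) (θ := θ₀)
    (fun x => ∃ k ∈ (Finset.univ : Finset (Idx m ⊕ Idx m)), bad k x)
  refine le_trans (by linarith) (Pr_mono (φ := fun x =>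
    ¬ ∃ k ∈ (Finset.univ : Finset (Idx m ⊕ Idx m)), bad k x) fun x _ hx => ?_)
  push Not at hx
  refine ⟨fun l => not_lt.1 (hx (Sum.inl l) (Finset.mem_univ _)), fun k => ?_⟩
  refine lt_of_le_of_lt ?_ (not_le.1 (hx (Sum.inr k) (Finset.mem_univ _)))
  exact mul_le_mul_of_nonneg_right (Finset.inf'_le _ (Finset.mem_univ k)) (Real.sqrt_nonneg _)

end Asymptotics

section Consistency

open Filter Topology

variable {m : ℕ} {v : (n : ℕ) → Fin n → Fin m → E} {w : E → E → ℝ} {g : E → ℝ}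
  {θ₀ : Idx m → ℝ} {Θ : Set (Idx m → ℝ)} {I : Matrix (Idx m) (Idx m) ℝ} {R : ℝ}

theorem abs_Emean_sub_le {n : ℕ} (hR0 : 1 ≤ R)
    (hR : ∀ q a i, |dyadStat n m (v n) w g q a i| ≤ R) {θ : Idx m → ℝ}
    (hθ1 : ‖θ - θ₀‖ ≤ 1) (hθ : Fintype.card (Idx m) * R * ‖θ - θ₀‖ ≤ 1) (l : Idx m) :
    |Emean n m (v n) w g θ (fun x => svec n m (v n) w g x l)
        - Emean n m (v n) w g θ₀ (fun x => svec n m (v n) w g x l)|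
      ≤ (18 * R * (Fintype.card (Idx m) * R) ^ 2 + Fintype.card (Idx m) * (2 * R * R))
        * Ndyads n * ‖θ - θ₀‖ := by
  have h1 := abs_Emean_sub_sub_le hR hθ l
  have h2 := abs_dotProduct_le (u := θ - θ₀) (y := Ifish n m (v n) w g θ₀ l)
    (fun k => abs_Ifish_le hR l k)
  rw [dotProduct_comm, dotProduct] at h2
  have hN : (0 : ℝ) ≤ Ndyads n := Nat.cast_nonneg _
  have h3 : ‖θ - θ₀‖ ^ 2 ≤ ‖θ - θ₀‖ := by nlinarith [norm_nonneg (θ - θ₀)]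
  have h4 : (Ndyads n : ℝ) * (18 * R * (Fintype.card (Idx m) * R * ‖θ - θ₀‖) ^ 2)
      ≤ 18 * R * (Fintype.card (Idx m) * R) ^ 2 * Ndyads n * ‖θ - θ₀‖ := by
    calc _ = 18 * R * (Fintype.card (Idx m) * R) ^ 2 * Ndyads n * ‖θ - θ₀‖ ^ 2 := by ring
      _ ≤ _ := mul_le_mul_of_nonneg_left h3 (by positivity)
  have h5 := abs_add_le
    (Emean n m (v n) w g θ (fun x => svec n m (v n) w g x l)
      - Emean n m (v n) w g θ₀ (fun x => svec n m (v n) w g x l)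
      - ∑ k, Ifish n m (v n) w g θ₀ l k * (θ - θ₀) k)
    (∑ k, Ifish n m (v n) w g θ₀ l k * (θ - θ₀) k)
  rw [sub_add_cancel] at h5
  linarith

/-- Near `θ₀`, an interior solution of the likelihood equations with a vanishing coordinate
would make the corresponding projection of the score small. -/
theorem abs_sum_score_le_of_svec_eq {n : ℕ} {x : Fin n → Fin n → Bool} (hR0 : 1 ≤ R)
    (hR : ∀ q a i, |dyadStat n m (v n) w g q a i| ≤ R) {θ b : Idx m → ℝ} {ε δ : ℝ}
    {k : Idx m} (hε : 0 ≤ ε)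
    (hI : ∀ k l, |Ifish n m (v n) w g θ₀ k l - Ndyads n * I k l| ≤ ε * Ndyads n)
    (hb : ∀ j, ∑ l, b l * I l j = if k = j then 1 else 0)
    (hs : ∀ l, svec n m (v n) w g x l = Emean n m (v n) w g θ (fun x => svec n m (v n) w g x l))
    (hθ : Fintype.card (Idx m) * R * ‖θ - θ₀‖ ≤ 1) (hδ : √(Ndyads n) * ‖θ - θ₀‖ ≤ δ)
    (hk : (θ - θ₀) k = 0) :
    |∑ l, b l * scoreVec v w g θ₀ n x l|
      ≤ (∑ l, |b l|) * (18 * R * (Fintype.card (Idx m) * R) ^ 2 * δ ^ 2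
        + Fintype.card (Idx m) * ε * δ * √(Ndyads n)) := by
  have hNsq : √(Ndyads n : ℝ) ^ 2 = Ndyads n := Real.sq_sqrt (Nat.cast_nonneg _)
  have hsN := Real.sqrt_nonneg (Ndyads n : ℝ)
  refine (abs_sum_mul_score_le (C := 18 * R * (Fintype.card (Idx m) * R) ^ 2 * δ ^ 2)
    (fun l => ?_) hI hb hk).trans ?_
  · rw [scoreVec, hs l]
    refine (abs_Emean_sub_sub_le hR hθ l).trans ?_
    have h1 : (√(Ndyads n) * ‖θ - θ₀‖) ^ 2 ≤ δ ^ 2 :=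
      pow_le_pow_left₀ (by positivity) hδ 2
    calc _ = 18 * R * (Fintype.card (Idx m) * R) ^ 2 * (√(Ndyads n) * ‖θ - θ₀‖) ^ 2 := by
          rw [mul_pow (√_), hNsq]; ring
      _ ≤ _ := mul_le_mul_of_nonneg_left h1 (by positivity)
  · refine mul_le_mul_of_nonneg_left (add_le_add le_rfl ?_)
      (Finset.sum_nonneg fun _ _ => abs_nonneg _)
    calc _ = Fintype.card (Idx m) * ε * (√(Ndyads n) * ‖θ - θ₀‖) * √(Ndyads n) := by
          rw [← hNsq, Real.sqrt_sq hsN]; ring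
      _ ≤ _ := by gcongr

/-- For a typical score, the realized log-likelihood is regular. -/
theorem exists_eventually_likelihoodRegular (hC1 : CondC1 m v w g θ₀ Θ)
    (hC2 : CondC2 m v w g θ₀ I) (hR0 : 1 ≤ R)
    (hR : ∀ n q a i, |dyadStat n m (v n) w g q a i| ≤ R) {b : Idx m → Idx m → ℝ}
    (hb : ∀ k j, ∑ l, b k l * I l j = if k = j then 1 else 0) {M κ : ℝ} (hM : 0 < M)
    (hκ : 0 < κ) :
    ∃ c A C ρ, 0 < c ∧ 0 < A ∧ 0 ≤ C ∧ 0 < ρ ∧ ∀ᶠ n in atTop,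
      ∀ x ∈ nets n, TypicalScore v w g θ₀ b M κ n x →
        LikelihoodRegular Θ θ₀ (fun θ => Llik n m (v n) w g θ x) (svec n m (v n) w g x)
          (fun θ l => Emean n m (v n) w g θ (fun x => svec n m (v n) w g x l))
          c A C ρ (Ndyads n) := by
  obtain ⟨-, hΘ, -, hθ₀Θ⟩ := hC1
  obtain ⟨c, hc, hI⟩ := exists_eventually_mul_sq_le_Ifish hC2
  obtain ⟨D, hD⟩ := hΘ.isBounded.subset_closedBall θ₀
  obtain ⟨ρ₀, hρ₀, hball⟩ := Metric.isOpen_iff.1 isOpen_interior θ₀ hθ₀Θ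
  set d : ℝ := ((Fintype.card (Idx m) : ℕ) : ℝ) with hd
  have hd1 : 1 ≤ d := by rw [hd]; exact_mod_cast Nat.one_le_iff_ne_zero.2 Fintype.card_ne_zero
  have hd0 : 0 < d := by linarith
  have hRpos : 0 < R := by linarith
  set K : ℝ := 2 + 2 * (d * R * |D|) with hK
  have hK2 : 2 ≤ K := by rw [hK]; linarith [show 0 ≤ 2 * (d * R * |D|) by positivity]
  set c' : ℝ := c / (2 * K ^ 2) with hc'
  have hc'0 : 0 < c' := by positivity
  set A : ℝ := d * M with hA
  have hA0 : 0 < A := by positivity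
  set δ : ℝ := A / c' with hδ
  have hδ0 : 0 < δ := by positivity
  set ρ : ℝ := min ρ₀ (1 / (d * R)) with hρ
  have hρ0 : 0 < ρ := by positivity
  have hρR : ∀ t : ℝ, t ≤ ρ → d * R * t ≤ 1 := fun t ht => by
    have h1 : t ≤ 1 / (d * R) := ht.trans (min_le_right _ _)
    rwa [le_div_iff₀ (by positivity), mul_comm] at h1
  have hρ1 : ρ ≤ 1 := by
    refine (min_le_right _ _).trans ?_
    rw [div_le_iff₀ (by positivity), one_mul]
    nlinarith
  set β : ℝ := ∑ k, ∑ l, |b k l| + 1 with hβ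
  have hβk : ∀ k, ∑ l, |b k l| ≤ β := fun k => by
    have := Finset.single_le_sum (f := fun k => ∑ l, |b k l|)
      (fun k _ => Finset.sum_nonneg fun l _ => abs_nonneg _) (Finset.mem_univ k)
    rw [hβ]
    linarith
  have hβ0 : 0 < β := by
    have : 0 ≤ ∑ k, ∑ l, |b k l| := Finset.sum_nonneg fun k _ => Finset.sum_nonneg fun l _ =>
      abs_nonneg _
    rw [hβ]; linarith
  set ε : ℝ := κ / (2 * β * d * δ) with hε
  have hε0 : 0 < ε := by positivity
  set C' : ℝ := 18 * R * (d * R) ^ 2 with hC'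
  refine ⟨c', A, C' + d * (2 * R * R), ρ, hc'0, hA0, by positivity, hρ0, ?_⟩
  filter_upwards [hI, eventually_abs_Ifish_sub_le hC2 hε0,
    tendsto_Ndyads.eventually_gt_atTop 0, tendsto_sqrt_Ndyads.eventually_gt_atTop (δ / ρ),
    tendsto_sqrt_Ndyads.eventually_ge_atTop (2 * (β * (C' * δ ^ 2)) / κ)]
    with n hIn hIε hN hNρ hNκ x _ hx
  have hsN : 0 < √(Ndyads n : ℝ) := Real.sqrt_pos.2 hN
  have hquad : ∀ θ ∈ Θ, Llik n m (v n) w g θ x - Llik n m (v n) w g θ₀ x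
      ≤ A * √(Ndyads n) * ‖θ - θ₀‖ - c' * Ndyads n * ‖θ - θ₀‖ ^ 2 := fun θ hθ => by
    have hθD : ‖θ - θ₀‖ ≤ |D| := (mem_closedBall_iff_norm.1 (hD hθ)).trans (le_abs_self D)
    have h1 := Llik_sub_le_sub_quadratic (θ := θ) (θ' := θ₀) (hR n) hK2 (by
      rw [← hd, hK]
      linarith [mul_le_mul_of_nonneg_left hθD (show 0 ≤ d * R by positivity)]) x
    have h2 := (le_abs_self _).trans (abs_dotProduct_le (u := θ - θ₀) hx.1)
    have h3 : c' * Ndyads n * ‖θ - θ₀‖ ^ 2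
        ≤ (θ - θ₀) ⬝ᵥ (Ifish n m (v n) w g θ₀).mulVec (θ - θ₀) / (2 * K ^ 2) := by
      rw [le_div_iff₀ (by positivity), hc']
      refine le_trans (le_of_eq ?_) (hIn (θ - θ₀))
      field_simp
    have h4 : d * (M * √(Ndyads n)) * ‖θ - θ₀‖ = A * √(Ndyads n) * ‖θ - θ₀‖ := by
      rw [hA]; ring
    rw [← hd, h4] at h2
    exact h1.trans (sub_le_sub h2 h3)
  have hρball : ∀ θ, ‖θ - θ₀‖ < ρ → θ ∈ interior Θ := fun θ hθ =>
    hball (mem_ball_iff_norm.2 (hθ.trans_le (min_le_left _ _)))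
  refine ⟨hquad, fun θ θ' => Llik_sub_le n m (v n) w g θ θ' x, fun θ hθ l => ?_,
    fun θ hθ => interior_subset (hρball θ hθ), fun θ hθ hmax k hk0 hk => ?_⟩
  · have h1 := abs_Emean_sub_le hR0 (hR n) (hθ.trans hρ1) (hρR _ hθ) l
    have h2 := hx.1 l
    have h3 : M * √(Ndyads n) ≤ A * √(Ndyads n) :=
      mul_le_mul_of_nonneg_right (by rw [hA]; nlinarith) hsN.le
    have h4 := abs_sub (scoreVec v w g θ₀ n x l)
      (Emean n m (v n) w g θ (fun x => svec n m (v n) w g x l)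
        - Emean n m (v n) w g θ₀ (fun x => svec n m (v n) w g x l))
    have h5 : svec n m (v n) w g x l - Emean n m (v n) w g θ (fun x => svec n m (v n) w g x l)
        = scoreVec v w g θ₀ n x l
          - (Emean n m (v n) w g θ (fun x => svec n m (v n) w g x l)
            - Emean n m (v n) w g θ₀ (fun x => svec n m (v n) w g x l)) := by
      rw [scoreVec]; ring
    rw [h5]
    exact h4.trans (add_le_add (h2.trans h3) h1)
  · have h1 : √(Ndyads n) * ‖θ - θ₀‖ ≤ δ := sqrt_mul_norm_le_of_le
      (L := fun θ => Llik n m (v n) w g θ x) hc'0 hA0.le hN (hquad θ hθ)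
      (hmax θ₀ (interior_subset hθ₀Θ))
    have h2 : ‖θ - θ₀‖ < ρ := by
      rw [div_lt_iff₀ hρ0] at hNρ
      exact lt_of_mul_lt_mul_left (h1.trans_lt hNρ) hsN.le
    have h3 := abs_sum_score_le_of_svec_eq hR0 (hR n) hε0.le hIε (hb k)
      (fun l => svec_eq_Emean_of_isMaxOn (hρball θ h2) hmax l) (hρR _ h2.le) h1
      (by rw [Pi.sub_apply, hk, hk0, sub_zero])
    have h4 : (∑ l, |b k l|) * (C' * δ ^ 2 + d * ε * δ * √(Ndyads n))
        ≤ β * (C' * δ ^ 2 + d * ε * δ * √(Ndyads n)) :=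
      mul_le_mul_of_nonneg_right (hβk k) (by positivity)
    have h5 : β * (d * ε * δ * √(Ndyads n)) = κ / 2 * √(Ndyads n) := by
      rw [hε]; field_simp
    rw [div_le_iff₀ hκ] at hNκ
    have h6 := hx.2 k
    linarith

theorem NBICval_eq_infoCrit (n : ℕ) (θ : Idx m → ℝ) (x : Fin n → Fin n → Bool) :
    NBICval n m (v n) w g θ x = infoCrit (Ndyads n) (Real.log (Ndyads n))
      (fun θ => Llik n m (v n) w g θ x) θ := by
  simp only [NBICval, infoCrit]

end Consistency

section SampleSize

open Filter Topology

theorem add_mul_sqrt_lt {A C D a r : ℝ} (hD : 0 < D) (ha : 0 < a) (hr0 : 0 ≤ r)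
    (hr : 2 / a * (A + C ^ 2 * D / (2 * a)) < r) : A + C * √(D * r) < a * r := by
  have hs : √(D * r) ^ 2 = D * r := Real.sq_sqrt (by positivity)
  have h1 : 0 ≤ (a * √(D * r) - C * D) ^ 2 / (2 * a * D) := by positivity
  have h2 : (a * √(D * r) - C * D) ^ 2 / (2 * a * D)
      = a * (√(D * r) ^ 2 / D) / 2 - C * √(D * r) + C ^ 2 * D / (2 * a) := by
    field_simp; ring
  rw [h2, hs, mul_div_cancel_left₀ _ hD.ne'] at h1
  have h3 : A + C ^ 2 * D / (2 * a) < a * r / 2 := by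
    rw [div_mul_eq_mul_div, div_lt_iff₀ ha] at hr
    linarith
  linarith

theorem eventually_sampleSize {c A C D ρ ν c₁ c₂ d : ℝ} (hc : 0 < c) (hA : 0 < A) (hD : 0 < D)
    (hρ : 0 < ρ) (hν : 0 < ν) (hc₁ : 0 < c₁) :
    ∀ᶠ n in atTop, 0 < (Ndyads n : ℝ) ∧ 2 ≤ Real.log (Ndyads n) ∧
      D * Real.log (Ndyads n) / Ndyads n < ρ ^ 2 ∧ D * Real.log (Ndyads n) / Ndyads n < ν ^ 2 ∧
      A + C * √(D * Real.log (Ndyads n)) < c₁ * c * Real.log (Ndyads n) / A ∧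
      2 * (d * c₂) ≤ √(Ndyads n) ∧
      √(Ndyads n) * (1 + Real.log (Ndyads n) * d) + A ^ 2 / c / 2 + d * c₂ * Real.log (Ndyads n)
        ≤ c * ν ^ 2 / 2 * Ndyads n := by
  have hlogdiv : Tendsto (fun n => Real.log (Ndyads n : ℝ) / Ndyads n) atTop (𝓝 0) :=
    Real.isLittleO_log_id_atTop.tendsto_div_nhds_zero.comp tendsto_Ndyads
  have h1 := hlogdiv.const_mul D
  have h2 := hlogdiv.const_mul (d * c₂)
  have h3 := tendsto_log_div_sqrt_Ndyads.const_mul d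
  rw [mul_zero] at h1 h2 h3
  set q : ℝ := c * ν ^ 2 / 8 with hq
  have hq0 : 0 < q := by positivity
  filter_upwards [tendsto_Ndyads.eventually_gt_atTop 0, tendsto_log_Ndyads.eventually_ge_atTop 2,
    h1.eventually_lt_const (show 0 < ρ ^ 2 by positivity),
    h1.eventually_lt_const (show 0 < ν ^ 2 by positivity),
    tendsto_log_Ndyads.eventually_gt_atTop
      (2 / (c₁ * c / A) * (A + C ^ 2 * D / (2 * (c₁ * c / A)))),
    tendsto_sqrt_Ndyads.eventually_ge_atTop (2 * (d * c₂)),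
    tendsto_sqrt_Ndyads.eventually_ge_atTop (1 / q),
    h3.eventually_lt_const hq0, tendsto_Ndyads.eventually_ge_atTop (A ^ 2 / c / 2 / q),
    h2.eventually_lt_const hq0] with n hN hr hρn hνn hbig hover hu1 hu2 hu3 hu4
  have hsN : 0 < √(Ndyads n : ℝ) := Real.sqrt_pos.2 hN
  have hNsq : √(Ndyads n : ℝ) * √(Ndyads n : ℝ) = Ndyads n := Real.mul_self_sqrt hN.le
  refine ⟨hN, hr, by rwa [mul_div_assoc], by rwa [mul_div_assoc], ?_, hover, ?_⟩
  · have := add_mul_sqrt_lt hD (show 0 < c₁ * c / A by positivity) (by linarith) hbig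
    rwa [div_mul_eq_mul_div] at this
  · rw [div_le_iff₀ hq0] at hu1 hu3
    rw [← mul_div_assoc, div_lt_iff₀ hsN] at hu2
    rw [← mul_div_assoc, div_lt_iff₀ hN] at hu4
    have hu1' := mul_le_mul_of_nonneg_left hu1 hsN.le
    have hu2' := mul_le_mul_of_nonneg_left hu2.le hsN.le
    have e1 : √(Ndyads n : ℝ) * (√(Ndyads n : ℝ) * q) = q * Ndyads n := by
      linear_combination q * hNsq
    have e2 : √(Ndyads n : ℝ) * (q * √(Ndyads n : ℝ)) = q * Ndyads n := by
      linear_combination q * hNsq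
    rw [e1] at hu1'
    rw [e2] at hu2'
    have e3 : c * ν ^ 2 / 2 * (Ndyads n : ℝ) = 4 * (q * Ndyads n) := by rw [hq]; ring
    rw [e3]
    linarith

theorem tendsto_Pr_one {m : ℕ} {v : (n : ℕ) → Fin n → Fin m → E} {w : E → E → ℝ} {g : E → ℝ}
    {θ₀ : Idx m → ℝ} {φ : (n : ℕ) → (Fin n → Fin n → Bool) → Prop}
    (h : ∀ ε > 0, ∀ᶠ n in atTop, 1 - ε ≤ Pr n m (v n) w g θ₀ (φ n)) :
    Tendsto (fun n => Pr n m (v n) w g θ₀ (φ n)) atTop (𝓝 1) := by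
  refine tendsto_order.2 ⟨fun a ha => ?_, fun a ha => Eventually.of_forall fun n =>
    (Pr_le_one _).trans_lt ha⟩
  filter_upwards [h ((1 - a) / 2) (by linarith)] with n hn
  linarith

end SampleSize

/-- The rows of the inverse of a positive definite matrix. -/
theorem exists_dual_rows_of_posDef {ι : Type*} [Fintype ι] [DecidableEq ι] {I : Matrix ι ι ℝ}
    (hI : I.PosDef) : ∃ b : ι → ι → ℝ, (∀ k, b k ≠ 0) ∧
      ∀ k j, ∑ l, b k l * I l j = if k = j then 1 else 0 := by
  have h : ∀ k j, ∑ l, I⁻¹ k l * I l j = if k = j then 1 else 0 := fun k j => by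
    rw [← Matrix.mul_apply, Matrix.nonsing_inv_mul _ ((Matrix.isUnit_iff_isUnit_det _).1 hI.isUnit),
      Matrix.one_apply]
  refine ⟨fun k l => I⁻¹ k l, fun k hk => ?_, h⟩
  have h1 := h k k
  rw [if_pos rfl, Finset.sum_eq_zero fun l _ => by
    rw [show I⁻¹ k l = 0 from congrFun hk l, zero_mul]] at h1
  exact zero_ne_one h1

/-- **Theorem 3, NBIC selection consistency.** Under conditions (C1)
and (C2), with adaptive weights `w_k = 1/|θ̂_{MLE,k}|`, for any deterministic
reference sequence `λ°_N ≍ log N` of regularization parameters, the probability that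
`inf_{λ ∈ Ω₋ ∪ Ω₊} NBIC_λ > NBIC_{λ°_N}` tends to one as `N → ∞`; here `Ω₋` is the
set of tuning parameters whose selected model misses part of the true support `A`,
and `Ω₊` the set whose selected model strictly contains `A`. -/
theorem nbic_selection_consistency {E : Type*} (m : ℕ) (hm : 1 ≤ m)
    (v : (n : ℕ) → Fin n → Fin m → E) (w : E → E → ℝ) (g : E → ℝ)
    (hw : ∀ u u' : E, w u u' = w u' u)
    (θ0 : Idx m → ℝ) (Θ : Set (Idx m → ℝ)) (Imat : Matrix (Idx m) (Idx m) ℝ)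
    (hC1 : CondC1 m v w g θ0 Θ) (hC2 : CondC2 m v w g θ0 Imat)
    (hA : ((Finset.univ : Finset (Idx m)).filter fun k => θ0 k ≠ 0).Nonempty)
    (hAc : ((Finset.univ : Finset (Idx m)).filter fun k => θ0 k = 0).Nonempty)
    -- the (unpenalized) maximum likelihood estimator used to build the weights
    (θMLE : (n : ℕ) → (Fin n → Fin n → Bool) → (Idx m → ℝ))
    (hMLE : ∀ (n : ℕ) (x : Fin n → Fin n → Bool), x ∈ nets n →
      θMLE n x ∈ Θ ∧ ∀ θ ∈ Θ, Llik n m (v n) w g θ x ≤ Llik n m (v n) w g (θMLE n x) x)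
    -- the regularized estimators `θ̂_λ` with adaptive weights `w_k = 1/|θ̂_{MLE,k}|`
    (θhatP : (n : ℕ) → ℝ → (Fin n → Fin n → Bool) → (Idx m → ℝ))
    (hθhatP : ∀ (n : ℕ) (lam : ℝ) (x : Fin n → Fin n → Bool), x ∈ nets n → 0 ≤ lam →
      θhatP n lam x ∈ Θ ∧ ∀ θ ∈ Θ,
        -Llik n m (v n) w g (θhatP n lam x) x
            + lam * ∑ k, |θMLE n x k|⁻¹ * |θhatP n lam x k|
          ≤ -Llik n m (v n) w g θ x + lam * ∑ k, |θMLE n x k|⁻¹ * |θ k|)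
    -- the reference regularization parameter `λ°_N ≍ log N`
    (lam0 : ℕ → ℝ)
    (hlam0 : ∃ c1 c2 : ℝ, 0 < c1 ∧ c1 ≤ c2 ∧
      ∀ᶠ n : ℕ in Filter.atTop,
        c1 * Real.log (Ndyads n) ≤ lam0 n ∧ lam0 n ≤ c2 * Real.log (Ndyads n)) :
    Filter.Tendsto
      (fun n : ℕ => Pr n m (v n) w g θ0
        (fun x =>
          NBICval n m (v n) w g (θhatP n (lam0 n) x) x
            < sInf ((fun lam : ℝ => NBICval n m (v n) w g (θhatP n lam x) x) ''
                ({lam : ℝ | 0 ≤ lam ∧ ¬ (∀ k, θ0 k ≠ 0 → θhatP n lam x k ≠ 0)}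
                  ∪ {lam : ℝ | 0 ≤ lam ∧ (∀ k, θ0 k ≠ 0 → θhatP n lam x k ≠ 0)
                      ∧ ∃ k, θ0 k = 0 ∧ θhatP n lam x k ≠ 0}))))
      Filter.atTop (nhds 1) := by
  
  obtain ⟨R, hR0, hR⟩ := exists_dyadStat_bound hC1
  obtain ⟨b, hb0, hb⟩ := exists_dual_rows_of_posDef hC2.2
  obtain ⟨c₁, c₂, hc₁, hc₁₂, hlam⟩ := hlam0
  have hc₂ : 0 < c₂ := hc₁.trans_le hc₁₂
  obtain ⟨k₁, hk₁⟩ := hAc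
  have hk₁0 : θ0 k₁ = 0 := (Finset.mem_filter.1 hk₁).2
  obtain ⟨ν, hν0, hν⟩ : ∃ ν > 0, ∀ k, θ0 k ≠ 0 → ν ≤ |θ0 k| :=
    ⟨Finset.inf' _ hA fun k => |θ0 k|,
      (Finset.lt_inf'_iff hA).2 fun k hk => abs_pos.2 (Finset.mem_filter.1 hk).2,
      fun k hk => Finset.inf'_le (fun k => |θ0 k|) (by simp [hk])⟩
  refine tendsto_Pr_one fun ε hε => ?_
  obtain ⟨M, κ, hM, hκ, hPr⟩ :=
    exists_eventually_typicalScore hR0 hR hC2 hb0 hε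
  obtain ⟨c, A, C, ρ, hc, hA0, hC, hρ, hreg⟩ :=
    exists_eventually_likelihoodRegular hC1 hC2 hR0 hR hb hM hκ
  filter_upwards [hPr, hreg, hlam, eventually_sampleSize (C := C) (c₂ := c₂)
    (d := (Fintype.card (Idx m) : ℕ)) (D := (A ^ 2 / c + 2 * (Fintype.card (Idx m) * c₂)) / c)
    hc hA0 (by positivity) hρ hν0 hc₁] with n hPrn hregn hlamn hn
  obtain ⟨hN, hr, hDρ, hDν, hbig, hover, hunder⟩ := hn
  have hlam0n : 0 ≤ lam0 n := le_trans (by positivity) hlamn.1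
  refine hPrn.trans (Pr_mono fun x hx htyp => ?_)
  have hreg := hregn x hx htyp
  have hpen := hθhatP n (lam0 n) x hx hlam0n
  have hsupp := support_eq_of_regular hreg hc hA0 hC hρ hN hc₁ hν0 hν (by linarith) hlamn rfl
    hDρ hDν hbig (hMLE n x hx) hpen.1 hpen.2
  refine lt_of_lt_of_le (lt_add_one _) (le_csInf ?_ ?_)
  · have h0 := hθhatP n 0 x hx le_rfl
    have hk : θhatP n 0 x k₁ ≠ 0 := hreg.nonzero _ h0.1
      (fun θ' hθ' => by simpa only [zero_mul, add_zero, neg_le_neg_iff] using h0.2 θ' hθ') k₁ hk₁0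
    refine Set.Nonempty.image _ ⟨0, ?_⟩
    by_cases h : ∀ k, θ0 k ≠ 0 → θhatP n 0 x k ≠ 0
    · exact Or.inr ⟨le_rfl, h, k₁, hk₁0, hk⟩
    · exact Or.inl ⟨le_rfl, h⟩
  · rintro _ ⟨lam, hlamΩ, rfl⟩
    have hnn : 0 ≤ lam := hlamΩ.elim (fun h => h.1) (fun h => h.1)
    have hsel := hlamΩ.imp (fun h => h.2) (fun h => h.2)
    simp only [NBICval_eq_infoCrit]
    exact infoCrit_add_one_le_of_regular hreg hc hρ hN hν0 hν hr hlam0n hlamn.2 hover hunder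
      (hMLE n x hx) hpen.2 hsupp (hθhatP n lam x hx hnn).1 hsel
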